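/- arXiv:math/0303199 — 2 statements merged into one kernel-verified Lean document; each statement's English description precedes it below -/
import Mathlib

section
/- Let r > 0 and let (u_n) be a sequence of C² solutions of the minimal surfaces equation on the open disk D(0,r) ⊂ ℝ². Suppose the downward unit normals N_n(0) at the origin converge to (1,0,0). Then for every α ∈ (0,1), the integrals of the horizontal component of the normal along the vertical segment satisfy ∫_{−αr}^{αr} (p_n/W_n)(0,y) dy → 2αr as n → ∞; equivalently, p_n/W_n(0,·) converges to the constant function 1 in L¹([−αr, αr]). -/
open Real Filter Set Topology MeasureTheory

/-- Partial derivative in the first (x) variable. -/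
noncomputable def pd1 (u : ℝ × ℝ → ℝ) (z : ℝ × ℝ) : ℝ := deriv (fun t => u (t, z.2)) z.1

/-- Partial derivative in the second (y) variable. -/
noncomputable def pd2 (u : ℝ × ℝ → ℝ) (z : ℝ × ℝ) : ℝ := deriv (fun t => u (z.1, t)) z.2

/-- `W = √(1 + p² + q²)` for the function `u`. -/
noncomputable def Wg (u : ℝ × ℝ → ℝ) (z : ℝ × ℝ) : ℝ :=
  Real.sqrt (1 + pd1 u z ^ 2 + pd2 u z ^ 2)

/-- `u` is a C² solution of the minimal surfaces equation
`(1+q²)r − 2pq·s + (1+p²)t = 0` on `Ω`. -/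
def IsMSE (u : ℝ × ℝ → ℝ) (Ω : Set (ℝ × ℝ)) : Prop :=
  ContDiffOn ℝ 2 u Ω ∧ ∀ z ∈ Ω,
    (1 + pd2 u z ^ 2) * pd1 (pd1 u) z
      - 2 * pd1 u z * pd2 u z * pd2 (pd1 u) z
      + (1 + pd1 u z ^ 2) * pd2 (pd2 u) z = 0

/-- Euclidean length of a planar vector. -/
noncomputable def len (v : ℝ × ℝ) : ℝ := Real.sqrt (v.1 ^ 2 + v.2 ^ 2)

/-- Euclidean open disk in the plane. -/
def eball (P : ℝ × ℝ) (ρ : ℝ) : Set (ℝ × ℝ) := {z | len (z - P) < ρ}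

/-- Downward unit normal of the graph of `u` at `z`. -/
noncomputable def Nvec (u : ℝ × ℝ → ℝ) (z : ℝ × ℝ) : ℝ × ℝ × ℝ :=
  (pd1 u z / Wg u z, pd2 u z / Wg u z, -1 / Wg u z)


/-- The real-linear map `v ↦ v.re • P + v.im • Q`. -/
noncomputable def lin {E : Type*} [NormedAddCommGroup E] [NormedSpace ℝ E] (P Q : E) : ℂ →L[ℝ] E :=
  Complex.reCLM.smulRight P + Complex.imCLM.smulRight Q

lemma lin_apply {E : Type*} [NormedAddCommGroup E] [NormedSpace ℝ E] (P Q : E) (v : ℂ) :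
    lin P Q v = v.re • P + v.im • Q := by
  simp [lin]

lemma lin_mul {f g : ℂ → ℝ} {a b c d : ℝ} {z : ℂ} (hf : HasFDerivAt f (lin a b) z)
    (hg : HasFDerivAt g (lin c d) z) :
    HasFDerivAt (fun w => f w * g w) (lin (f z * c + g z * a) (f z * d + g z * b)) z := by
  convert! hf.mul hg using 1
  ext v
  simp [lin_apply]
  ring

lemma lin_inv {f : ℂ → ℝ} {a b : ℝ} {z : ℂ} (hf : HasFDerivAt f (lin a b) z) (h0 : f z ≠ 0) :
    HasFDerivAt (fun w => (f w)⁻¹) (lin (-a / f z ^ 2) (-b / f z ^ 2)) z := by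
  have := (hasDerivAt_inv h0).comp_hasFDerivAt z hf
  convert! this using 1
  ext v
  simp [lin_apply]
  field_simp
  ring

lemma lin_sqrt {f : ℂ → ℝ} {a b : ℝ} {z : ℂ} (hf : HasFDerivAt f (lin a b) z) (h0 : f z ≠ 0) :
    HasFDerivAt (fun w => √(f w)) (lin (a / (2 * √(f z))) (b / (2 * √(f z)))) z := by
  have := hf.sqrt h0
  convert! this using 1
  ext v
  simp [lin_apply]
  field_simp

lemma lin_const_add {f : ℂ → ℝ} {a b : ℝ} {z : ℂ} (hf : HasFDerivAt f (lin a b) z) (k : ℝ) :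
    HasFDerivAt (fun w => k + f w) (lin a b) z := hf.const_add k

lemma lin_add {f g : ℂ → ℝ} {a b c d : ℝ} {z : ℂ} (hf : HasFDerivAt f (lin a b) z)
    (hg : HasFDerivAt g (lin c d) z) :
    HasFDerivAt (fun w => f w + g w) (lin (a + c) (b + d)) z := by
  convert! hf.add hg using 1
  ext v
  simp [lin_apply]
  ring

lemma lin_neg {f : ℂ → ℝ} {a b : ℝ} {z : ℂ} (hf : HasFDerivAt f (lin a b) z) :
    HasFDerivAt (fun w => - f w) (lin (-a) (-b)) z := by
  convert! hf.neg using 1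
  ext v
  simp [lin_apply]
  ring

lemma continuousAt_lin {E : Type*} [NormedAddCommGroup E] [NormedSpace ℝ E] {P Q : ℂ → E} {z : ℂ}
    (hP : ContinuousAt P z) (hQ : ContinuousAt Q z) :
    ContinuousAt (fun w => lin (P w) (Q w)) z := by
  unfold lin
  have h1 : ContinuousAt (fun w => ContinuousLinearMap.smulRightL ℝ ℂ E Complex.reCLM (P w)) z :=
    (ContinuousLinearMap.continuous _).continuousAt.comp hP
  have h2 : ContinuousAt (fun w => ContinuousLinearMap.smulRightL ℝ ℂ E Complex.imCLM (Q w)) z :=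
    (ContinuousLinearMap.continuous _).continuousAt.comp hQ
  exact h1.add h2

lemma exists_potential {r : ℝ} {P Q : ℂ → ℝ}
    (h : ∀ z ∈ Metric.ball (0:ℂ) r, ∃ a b c d, HasFDerivAt P (lin a b) z ∧ HasFDerivAt Q (lin d c) z ∧ b = d) :
    ∃ f : ℂ → ℝ, f 0 = 0 ∧ ∀ z ∈ Metric.ball (0:ℂ) r, HasFDerivAt f (lin (P z) (Q z)) z := by
  have key : ∀ z ∈ Metric.ball (0:ℂ) r, ∃ D : ℂ →L[ℝ] ℂ →L[ℝ] ℝ,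
      HasFDerivAt (fun w => lin (P w) (Q w)) D z ∧ ∀ x y, D x y = D y x := by
    intro z hz
    obtain ⟨a, b, c, d, h1, h2, rfl⟩ := h z hz
    have e1 := ((ContinuousLinearMap.smulRightL ℝ ℂ ℝ Complex.reCLM).hasFDerivAt).comp z h1
    have e2 := ((ContinuousLinearMap.smulRightL ℝ ℂ ℝ Complex.imCLM).hasFDerivAt).comp z h2
    refine ⟨_, e1.add e2, ?_⟩
    intro x y
    simp [lin_apply]
    ring
  obtain ⟨f, hf⟩ := (convex_ball (0:ℂ) r).exists_forall_hasFDerivAt_of_fderiv_symmetric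
    Metric.isOpen_ball (ω := fun w => lin (P w) (Q w))
    (fun z hz => by
      obtain ⟨D, hD, -⟩ := key z hz
      exact hD.differentiableAt.differentiableWithinAt)
    (fun z hz x y => by
      obtain ⟨D, hD, hs⟩ := key z hz
      rw [hD.fderiv]; exact hs x y)
  exact ⟨fun z => f z - f 0, by simp, fun z hz => (hf z hz).sub_const _⟩

/-- Data of a solution in complex form. -/
def Sol (r : ℝ) (u p q : ℂ → ℝ) : Prop :=
  ∀ z ∈ Metric.ball (0:ℂ) r, HasFDerivAt u (lin (p z) (q z)) z ∧
    ∃ R S T : ℝ, HasFDerivAt p (lin R S) z ∧ HasFDerivAt q (lin S T) z ∧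
      (1 + q z ^ 2) * R - 2 * p z * q z * S + (1 + p z ^ 2) * T = 0

noncomputable def WW (p q : ℂ → ℝ) (z : ℂ) : ℝ := √(1 + p z ^ 2 + q z ^ 2)

lemma WW_sq (p q : ℂ → ℝ) (z : ℂ) : WW p q z ^ 2 = 1 + p z ^ 2 + q z ^ 2 :=
  Real.sq_sqrt (by positivity)

lemma WW_pos (p q : ℂ → ℝ) (z : ℂ) : 0 < WW p q z := Real.sqrt_pos.2 (by positivity)

lemma WW_deriv {p q : ℂ → ℝ} {z : ℂ} {R S T : ℝ} (hp : HasFDerivAt p (lin R S) z)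
    (hq : HasFDerivAt q (lin S T) z) :
    HasFDerivAt (fun w => (WW p q w)⁻¹)
      (lin (-(p z * R + q z * S) / WW p q z ^ 3) (-(p z * S + q z * T) / WW p q z ^ 3)) z := by
  have h1 := lin_add (lin_const_add (lin_mul hp hp) 1) (lin_mul hq hq)
  have h0 : 0 < 1 + p z * p z + q z * q z := by nlinarith [mul_self_nonneg (p z), mul_self_nonneg (q z)]
  have h2 := lin_inv (lin_sqrt h1 h0.ne') (Real.sqrt_pos.2 h0).ne'
  have e : ∀ w, √(1 + p w * p w + q w * q w) = WW p q w := fun w => by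
    simp [WW, sq]
  simp only [e] at h2
  have hW := WW_pos p q z
  convert! h2 using 2 <;> field_simp <;> ring

lemma exists_psi {r : ℝ} {u p q : ℂ → ℝ} (h : Sol r u p q) :
    ∃ f : ℂ → ℝ, f 0 = 0 ∧ ∀ z ∈ Metric.ball (0:ℂ) r,
      HasFDerivAt f (lin (-q z / WW p q z) (p z / WW p q z)) z := by
  apply exists_potential (P := fun z => -q z / WW p q z) (Q := fun z => p z / WW p q z)
  intro z hz
  obtain ⟨-, R, S, T, hp, hq, hE⟩ := h z hz
  have hW := WW_pos p q z
  have hs := WW_sq p q z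
  have hd := WW_deriv hp hq
  refine ⟨_, _, _, _, lin_mul (lin_neg hq) hd, lin_mul hp hd, ?_⟩
  field_simp
  linear_combination (-R-T) * hs - hE

lemma exists_A {r : ℝ} {u p q : ℂ → ℝ} (h : Sol r u p q) :
    ∃ f : ℂ → ℝ, f 0 = 0 ∧ ∀ z ∈ Metric.ball (0:ℂ) r,
      HasFDerivAt f (lin ((1 + p z * p z) / WW p q z) (p z * q z / WW p q z)) z := by
  apply exists_potential (P := fun z => (1 + p z * p z) / WW p q z)
    (Q := fun z => p z * q z / WW p q z)
  intro z hz
  obtain ⟨-, R, S, T, hp, hq, hE⟩ := h z hz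
  have hW := WW_pos p q z
  have hs := WW_sq p q z
  have hd := WW_deriv hp hq
  refine ⟨_, _, _, _, lin_mul (lin_const_add (lin_mul hp hp) 1) hd, lin_mul (lin_mul hp hq) hd, ?_⟩
  field_simp
  linear_combination (p z * S - q z * R) * hs - q z * hE

lemma exists_B {r : ℝ} {u p q : ℂ → ℝ} (h : Sol r u p q) :
    ∃ f : ℂ → ℝ, f 0 = 0 ∧ ∀ z ∈ Metric.ball (0:ℂ) r,
      HasFDerivAt f (lin (p z * q z / WW p q z) ((1 + q z * q z) / WW p q z)) z := by
  apply exists_potential (P := fun z => p z * q z / WW p q z)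
    (Q := fun z => (1 + q z * q z) / WW p q z)
  intro z hz
  obtain ⟨-, R, S, T, hp, hq, hE⟩ := h z hz
  have hW := WW_pos p q z
  have hs := WW_sq p q z
  have hd := WW_deriv hp hq
  refine ⟨_, _, _, _, lin_mul (lin_mul hp hq) hd, lin_mul (lin_const_add (lin_mul hq hq) 1) hd, ?_⟩
  field_simp
  linear_combination (p z * T - q z * S) * hs + p z * hE

lemma harnack {r : ℝ} (hr : 0 < r) {h : ℂ → ℂ} (hd : DifferentiableOn ℂ h (Metric.ball 0 r))
    (hb : ∀ z ∈ Metric.ball (0:ℂ) r, ‖h z‖ ≤ 1) {z : ℂ} (hz : z ∈ Metric.ball (0:ℂ) r) :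
    ‖h z - 1‖ ≤ ‖h 0 - 1‖ * (r + ‖z‖) / (r - ‖z‖) := by
  have hz' : ‖z‖ < r := by simpa using hz
  have key : ∀ M > 0, ‖h z - 1‖ ≤ 2 * M * ‖z‖ / (r - ‖z‖) + ‖h 0 - 1‖ * (r + ‖z‖) / (r - ‖z‖) := by
    intro M hM
    refine Complex.borelCaratheodory (f := fun w => h w - 1) hM (hd.sub_const 1) ?_ hr hz
    intro w hw
    have := (Complex.re_le_norm (h w)).trans (hb w hw)
    simp; linarith
  have ht : Tendsto (fun M : ℝ => 2 * M * ‖z‖ / (r - ‖z‖) + ‖h 0 - 1‖ * (r + ‖z‖) / (r - ‖z‖))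
      (𝓝[>] 0) (𝓝 (2 * 0 * ‖z‖ / (r - ‖z‖) + ‖h 0 - 1‖ * (r + ‖z‖) / (r - ‖z‖))) := by
    apply Tendsto.mono_left _ nhdsWithin_le_nhds
    apply Continuous.tendsto (f := fun M : ℝ => 2 * M * ‖z‖ / (r - ‖z‖) + ‖h 0 - 1‖ * (r + ‖z‖) / (r - ‖z‖))
    fun_prop
  simp only [mul_zero, zero_mul, zero_div, zero_add] at ht
  exact ge_of_tendsto ht (by filter_upwards [self_mem_nhdsWithin] with M hM using key M hM)

lemma expanding {r : ℝ} {Φ a b : ℂ → ℂ}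
    (hΦ : ∀ z ∈ Metric.ball (0:ℂ) r, HasFDerivAt Φ (lin (a z) (b z)) z)
    (hpos : ∀ z ∈ Metric.ball (0:ℂ) r, ∀ v : ℂ,
      ‖v‖ ^ 2 ≤ (starRingEnd ℂ v * lin (a z) (b z) v).re) {z w : ℂ}
    (hz : z ∈ Metric.ball (0:ℂ) r) (hw : w ∈ Metric.ball (0:ℂ) r) :
    ‖z - w‖ ≤ ‖Φ z - Φ w‖ := by
  set v := z - w with hv
  have hmem : ∀ t ∈ Icc (0:ℝ) 1, w + t • v ∈ Metric.ball (0:ℂ) r := by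
    intro t ht
    have := (convex_ball (0:ℂ) r).add_smul_sub_mem hw hz ht
    simpa [hv] using this
  have hder : ∀ t ∈ Icc (0:ℝ) 1, HasDerivAt (fun t : ℝ => (starRingEnd ℂ v * Φ (w + t • v)).re)
      ((starRingEnd ℂ v * lin (a (w + t • v)) (b (w + t • v)) v).re) t := by
    intro t ht
    have h1 : HasDerivAt (fun t : ℝ => w + t • v) v t := by
      simpa using ((hasDerivAt_id t).smul_const v).const_add w
    have h2 := (hΦ _ (hmem t ht)).comp_hasDerivAt t h1
    have h3 := h2.const_mul (starRingEnd ℂ v)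
    exact Complex.reCLM.hasFDerivAt.comp_hasDerivAt t h3
  obtain ⟨t, ht, he⟩ := exists_hasDerivAt_eq_slope _ _ (zero_lt_one : (0:ℝ) < 1)
    (fun t ht => (hder t ht).continuousAt.continuousWithinAt)
    (fun t ht => hder t (Ioo_subset_Icc_self ht))
  have h5 := hpos _ (hmem t (Ioo_subset_Icc_self ht)) v
  rw [he] at h5
  have e1 : w + (1:ℝ) • v = z := by simp [hv]
  have e0 : w + (0:ℝ) • v = w := by simp
  rw [e1, e0, sub_zero, div_one, ← Complex.sub_re, ← mul_sub] at h5
  have h6 := h5.trans (Complex.re_le_norm _)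
  rw [norm_mul, RCLike.norm_conj] at h6
  by_cases h0 : ‖v‖ = 0
  · rw [h0]; positivity
  · have : 0 < ‖v‖ := lt_of_le_of_ne (norm_nonneg _) (Ne.symm h0)
    nlinarith

lemma exists_equiv {L : ℂ →L[ℝ] ℂ} (hpos : ∀ v : ℂ, ‖v‖ ^ 2 ≤ (starRingEnd ℂ v * L v).re) :
    ∃ e : ℂ ≃L[ℝ] ℂ, (e : ℂ →L[ℝ] ℂ) = L := by
  have hinj : Function.Injective (L : ℂ →ₗ[ℝ] ℂ) := by
    rw [← LinearMap.ker_eq_bot, LinearMap.ker_eq_bot']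
    intro v hv
    have := hpos v
    have hv' : L v = 0 := hv
    rw [hv'] at this
    simpa using this
  refine ⟨(LinearEquiv.ofInjectiveEndo _ hinj).toContinuousLinearEquiv, ?_⟩
  ext v
  simp

lemma surj {r : ℝ} (hr : 0 < r) {Φ a b : ℂ → ℂ} (h0 : Φ 0 = 0)
    (hΦ : ∀ z ∈ Metric.ball (0:ℂ) r, HasFDerivAt Φ (lin (a z) (b z)) z)
    (ha : ∀ z ∈ Metric.ball (0:ℂ) r, ContinuousAt a z)
    (hb : ∀ z ∈ Metric.ball (0:ℂ) r, ContinuousAt b z)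
    (hpos : ∀ z ∈ Metric.ball (0:ℂ) r, ∀ v : ℂ,
      ‖v‖ ^ 2 ≤ (starRingEnd ℂ v * lin (a z) (b z) v).re) :
    Metric.ball (0:ℂ) r ⊆ Φ '' Metric.ball (0:ℂ) r := by
  apply (convex_ball (0:ℂ) r).isPreconnected.subset_of_closure_inter_subset
  · rw [isOpen_iff_mem_nhds]
    rintro _ ⟨z, hz, rfl⟩
    obtain ⟨e, he⟩ := exists_equiv (hpos z hz)
    have hst : HasStrictFDerivAt Φ (e : ℂ →L[ℝ] ℂ) z := by
      rw [he]
      refine hasStrictFDerivAt_of_hasFDerivAt_of_continuousAt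
        (f' := fun z => lin (a z) (b z)) ?_ (continuousAt_lin (ha z hz) (hb z hz))
      filter_upwards [Metric.isOpen_ball.mem_nhds hz] with y hy using hΦ y hy
    rw [← hst.map_nhds_eq_of_equiv]
    exact image_mem_map (Metric.isOpen_ball.mem_nhds hz)
  · exact ⟨0, by simpa using hr, 0, by simpa using hr, h0⟩
  · rintro w ⟨hw, hwr⟩
    obtain ⟨x, hx, hlim⟩ := mem_closure_iff_seq_limit.1 hw
    choose y hy hyx using hx
    have hwr' : ‖w‖ < r := by simpa using hwr
    obtain ⟨ρ, h1, h2⟩ := exists_between hwr'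
    have hev : ∀ᶠ n in atTop, y n ∈ Metric.closedBall (0:ℂ) ρ := by
      have : ∀ᶠ n in atTop, ‖x n‖ < ρ := hlim.norm.eventually_lt_const h1
      filter_upwards [this] with n hn
      have := expanding hΦ hpos (hy n) (Metric.mem_ball_self hr)
      rw [h0, hyx] at this
      simp at this ⊢
      linarith
    obtain ⟨c, hc, φ, hφ, hlim2⟩ := (isCompact_closedBall (0:ℂ) ρ).tendsto_subseq' hev.frequently
    have hcr : c ∈ Metric.ball (0:ℂ) r := Metric.closedBall_subset_ball h2 hc
    refine ⟨c, hcr, ?_⟩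
    have h3 := (hΦ c hcr).continuousAt.tendsto.comp hlim2
    have h4 := hlim.comp hφ.tendsto_atTop
    refine tendsto_nhds_unique h3 (h4.congr fun n => ?_)
    simp [hyx]

lemma exists_inverse {r : ℝ} (hr : 0 < r) {Φ a b : ℂ → ℂ} (h0 : Φ 0 = 0)
    (hΦ : ∀ z ∈ Metric.ball (0:ℂ) r, HasFDerivAt Φ (lin (a z) (b z)) z)
    (ha : ∀ z ∈ Metric.ball (0:ℂ) r, ContinuousAt a z)
    (hb : ∀ z ∈ Metric.ball (0:ℂ) r, ContinuousAt b z)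
    (hpos : ∀ z ∈ Metric.ball (0:ℂ) r, ∀ v : ℂ,
      ‖v‖ ^ 2 ≤ (starRingEnd ℂ v * lin (a z) (b z) v).re) :
    ∃ Ψ : ℂ → ℂ, Ψ 0 = 0 ∧ ∀ ζ ∈ Metric.ball (0:ℂ) r, Ψ ζ ∈ Metric.ball (0:ℂ) r ∧ Φ (Ψ ζ) = ζ ∧
      ∀ (H : ℂ → ℂ) (c : ℂ), HasFDerivAt H (lin (c * a (Ψ ζ)) (c * b (Ψ ζ))) (Ψ ζ) →
        HasDerivAt (fun w => H (Ψ w)) c ζ := by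
  have hs := surj hr h0 hΦ ha hb hpos
  have : ∀ ζ : ℂ, ∃ z, ζ ∈ Metric.ball (0:ℂ) r → (z ∈ Metric.ball (0:ℂ) r ∧ Φ z = ζ) := by
    intro ζ
    by_cases h : ζ ∈ Metric.ball (0:ℂ) r
    · obtain ⟨z, hz⟩ := hs h
      exact ⟨z, fun _ => hz⟩
    · exact ⟨0, fun h' => absurd h' h⟩
  choose Ψ hΨ using this
  have hm : (0:ℂ) ∈ Metric.ball (0:ℂ) r := Metric.mem_ball_self hr
  refine ⟨Ψ, ?_, fun ζ hζ => ⟨(hΨ ζ hζ).1, (hΨ ζ hζ).2, ?_⟩⟩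
  · have := expanding hΦ hpos (hΨ 0 hm).1 hm
    rw [(hΨ 0 hm).2, h0] at this
    simpa using this
  · intro H c hH
    obtain ⟨e, he⟩ := exists_equiv (hpos _ (hΨ ζ hζ).1)
    have hnear : ∀ᶠ w in 𝓝 ζ, w ∈ Metric.ball (0:ℂ) r := Metric.isOpen_ball.mem_nhds hζ
    have hcont : ContinuousAt Ψ ζ := by
      rw [ContinuousAt, tendsto_iff_norm_sub_tendsto_zero]
      have hl : Tendsto (fun w => ‖w - ζ‖) (𝓝 ζ) (𝓝 0) := by
        have : Continuous (fun w : ℂ => ‖w - ζ‖) := by fun_prop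
        simpa using this.tendsto ζ
      refine squeeze_zero' (Eventually.of_forall fun _ => norm_nonneg _) ?_ hl
      filter_upwards [hnear] with w hw
      have := expanding hΦ hpos (hΨ w hw).1 (hΨ ζ hζ).1
      rwa [(hΨ w hw).2, (hΨ ζ hζ).2] at this
    have hd : HasFDerivAt Ψ (e.symm : ℂ →L[ℝ] ℂ) ζ := by
      refine HasFDerivAt.of_local_left_inverse (f := Φ) hcont ?_ ?_
      · rw [he]; exact hΦ _ (hΨ ζ hζ).1
      · filter_upwards [hnear] with w hw using (hΨ w hw).2
    have hcomp := hH.comp ζ hd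
    rw [hasDerivAt_iff_hasFDerivAt]
    refine hasFDerivAt_of_restrictScalars ℝ hcomp ?_
    ext v
    have h7 : lin (a (Ψ ζ)) (b (Ψ ζ)) (e.symm v) = v := by
      rw [← he]; simp
    have h8 : lin (c * a (Ψ ζ)) (c * b (Ψ ζ)) (e.symm v) = c * lin (a (Ψ ζ)) (b (Ψ ζ)) (e.symm v) := by
      simp [lin_apply]; ring
    simp [h8, h7, mul_comm]

noncomputable def ff (p q : ℂ → ℝ) (z : ℂ) : ℂ := ⟨p z / (1 + WW p q z), -q z / (1 + WW p q z)⟩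

lemma ff_norm (p q : ℂ → ℝ) (z : ℂ) : ‖ff p q z‖ ≤ 1 := by
  have hW := WW_pos p q z
  have hs := WW_sq p q z
  rw [← sq_le_one_iff₀ (norm_nonneg _), Complex.sq_norm, Complex.normSq_apply]
  simp only [ff]
  have : p z / (1 + WW p q z) * (p z / (1 + WW p q z)) +
      -q z / (1 + WW p q z) * (-q z / (1 + WW p q z)) = (p z ^ 2 + q z ^ 2) / (1 + WW p q z) ^ 2 := by
    field_simp
  rw [this, div_le_one (by positivity)]
  nlinarith

lemma hasFDerivAt_mk {f g : ℂ → ℝ} {a b c d : ℝ} {z : ℂ} (hf : HasFDerivAt f (lin a b) z)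
    (hg : HasFDerivAt g (lin c d) z) :
    HasFDerivAt (fun w => (⟨f w, g w⟩ : ℂ)) (lin (⟨a, c⟩ : ℂ) ⟨b, d⟩) z := by
  have h1 := (Complex.ofRealCLM.hasFDerivAt.comp z hf).add
    ((Complex.ofRealCLM.hasFDerivAt.comp z hg).mul_const Complex.I)
  have e : (fun w => (⟨f w, g w⟩ : ℂ)) = (Complex.ofRealCLM ∘ f + fun w => (Complex.ofRealCLM ∘ g) w * Complex.I) := by
    ext w; simp [Complex.mk_eq_add_mul_I]
  rw [e]
  convert! h1 using 1
  ext v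
  apply Complex.ext <;> simp [lin_apply]

lemma lin_norm_le {P Q : ℝ} (h : P ^ 2 + Q ^ 2 ≤ 1) : ‖lin P Q‖ ≤ 1 := by
  refine ContinuousLinearMap.opNorm_le_bound _ zero_le_one fun v => ?_
  rw [lin_apply, one_mul, Real.norm_eq_abs]
  apply abs_le_of_sq_le_sq _ (norm_nonneg _)
  rw [Complex.sq_norm, Complex.normSq_apply]
  simp only [smul_eq_mul]
  nlinarith [sq_nonneg (v.re * Q - v.im * P), sq_nonneg v.re, sq_nonneg v.im]

lemma hasFDerivAt_lin_re (z : ℂ) : HasFDerivAt (fun w : ℂ => w.re) (lin (1:ℝ) 0) z := by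
  convert! Complex.reCLM.hasFDerivAt using 1
  ext v; simp [lin_apply]

lemma hasFDerivAt_lin_im (z : ℂ) : HasFDerivAt (fun w : ℂ => w.im) (lin (0:ℝ) 1) z := by
  convert! Complex.imCLM.hasFDerivAt using 1
  ext v; simp [lin_apply]

lemma core_psi {r : ℝ} (hr : 0 < r) {u p q ψ : ℂ → ℝ} (h : Sol r u p q) (hψ0 : ψ 0 = 0)
    (hψ : ∀ z ∈ Metric.ball (0:ℂ) r, HasFDerivAt ψ (lin (-q z / WW p q z) (p z / WW p q z)) z)
    {α : ℝ} (hα : α ∈ Ioo (0:ℝ) 1) {β : ℝ} (hβ : |β| = α * r) :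
    |ψ ⟨0, β⟩ - β| ≤ 2 * (‖ff p q 0 - 1‖ * (1 + α) / (1 - α)) * (α * r) := by
  obtain ⟨A, hA0, hA⟩ := exists_A h
  obtain ⟨B, hB0, hB⟩ := exists_B h
  have hpc : ∀ z ∈ Metric.ball (0:ℂ) r, ContinuousAt p z := fun z hz => by
    obtain ⟨-, R, S, T, hp, hq, -⟩ := h z hz
    exact hp.continuousAt
  have hqc : ∀ z ∈ Metric.ball (0:ℂ) r, ContinuousAt q z := fun z hz => by
    obtain ⟨-, R, S, T, hp, hq, -⟩ := h z hz
    exact hq.continuousAt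
  have hWi : ∀ z ∈ Metric.ball (0:ℂ) r, ContinuousAt (fun z => (WW p q z)⁻¹) z := fun z hz => by
    obtain ⟨-, R, S, T, hp, hq, -⟩ := h z hz
    exact (WW_deriv hp hq).continuousAt
  set Φ : ℂ → ℂ := fun z => ⟨z.re + A z, z.im + B z⟩ with hΦdef
  set a : ℂ → ℂ := fun z => ⟨1 + (1 + p z * p z) / WW p q z, 0 + p z * q z / WW p q z⟩ with hadef
  set b : ℂ → ℂ := fun z => ⟨0 + p z * q z / WW p q z, 1 + (1 + q z * q z) / WW p q z⟩ with hbdef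
  have hΦ0 : Φ 0 = 0 := by simp [hΦdef, hA0, hB0]; rfl
  have hΦ : ∀ z ∈ Metric.ball (0:ℂ) r, HasFDerivAt Φ (lin (a z) (b z)) z := fun z hz =>
    hasFDerivAt_mk (lin_add (hasFDerivAt_lin_re z) (hA z hz)) (lin_add (hasFDerivAt_lin_im z) (hB z hz))
  have hmk : ∀ {f g : ℂ → ℝ} {z : ℂ}, ContinuousAt f z → ContinuousAt g z →
      ContinuousAt (fun w => (⟨f w, g w⟩ : ℂ)) z := by
    intro f g z hf hg
    simp only [Complex.mk_eq_add_mul_I]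
    fun_prop
  have ha : ∀ z ∈ Metric.ball (0:ℂ) r, ContinuousAt a z := fun z hz => by
    have := hpc z hz; have := hqc z hz; have := hWi z hz
    apply hmk <;> simp only [div_eq_mul_inv] <;> fun_prop
  have hb : ∀ z ∈ Metric.ball (0:ℂ) r, ContinuousAt b z := fun z hz => by
    have := hpc z hz; have := hqc z hz; have := hWi z hz
    apply hmk <;> simp only [div_eq_mul_inv] <;> fun_prop
  have hpos : ∀ z ∈ Metric.ball (0:ℂ) r, ∀ v : ℂ,
      ‖v‖ ^ 2 ≤ (starRingEnd ℂ v * lin (a z) (b z) v).re := by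
    intro z hz v
    have hW := WW_pos p q z
    have : (starRingEnd ℂ v * lin (a z) (b z) v).re = ‖v‖ ^ 2 +
        (v.re ^ 2 + v.im ^ 2 + (v.re * p z + v.im * q z) ^ 2) / WW p q z := by
      rw [Complex.sq_norm, Complex.normSq_apply]
      simp [lin_apply, hadef, hbdef]
      field_simp
      ring
    rw [this]
    have : 0 ≤ (v.re ^ 2 + v.im ^ 2 + (v.re * p z + v.im * q z) ^ 2) / WW p q z := by positivity
    linarith
  obtain ⟨Ψ, hΨ0, hΨ⟩ := exists_inverse hr hΦ0 hΦ ha hb hpos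
  -- the two holomorphic functions
  have hF : ∀ ζ ∈ Metric.ball (0:ℂ) r,
      HasDerivAt (fun w => (⟨u (Ψ w), ψ (Ψ w)⟩ : ℂ)) (ff p q (Ψ ζ)) ζ := by
    intro ζ hζ
    obtain ⟨hm, -, hH⟩ := hΨ ζ hζ
    refine hH (fun z => ⟨u z, ψ z⟩) _ ?_
    have := hasFDerivAt_mk (h _ hm).1 (hψ _ hm)
    convert this using 2
    all_goals
      have hW := WW_pos p q (Ψ ζ)
      have hs := WW_sq p q (Ψ ζ)
      apply Complex.ext <;> simp [ff, hadef, hbdef] <;> field_simp <;>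
        grind
  have hG : ∀ ζ ∈ Metric.ball (0:ℂ) r,
      HasDerivAt (fun w => (⟨(Ψ w).re - A (Ψ w), B (Ψ w) - (Ψ w).im⟩ : ℂ)) (-(ff p q (Ψ ζ)) ^ 2) ζ := by
    intro ζ hζ
    obtain ⟨hm, -, hH⟩ := hΨ ζ hζ
    refine hH (fun z => ⟨z.re - A z, B z - z.im⟩) _ ?_
    have := hasFDerivAt_mk (lin_add (hasFDerivAt_lin_re _) (lin_neg (hA _ hm)))
      (lin_add (hB _ hm) (lin_neg (hasFDerivAt_lin_im _)))
    simp only [← sub_eq_add_neg] at this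
    convert this using 2
    all_goals
      have hW := WW_pos p q (Ψ ζ)
      have hs := WW_sq p q (Ψ ζ)
      apply Complex.ext <;> simp [ff, hadef, hbdef, sq] <;> field_simp <;>
        grind
  have hα0 := hα.1
  have hα1 := hα.2
  have hαr : α * r < r := by nlinarith
  have hsub : Metric.closedBall (0:ℂ) (α * r) ⊆ Metric.ball 0 r := Metric.closedBall_subset_ball hαr
  have hd : DifferentiableOn ℂ (fun ζ => ff p q (Ψ ζ)) (Metric.ball 0 r) := by
    have h1 : DifferentiableOn ℂ (fun w => (⟨u (Ψ w), ψ (Ψ w)⟩ : ℂ)) (Metric.ball 0 r) :=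
      fun ζ hζ => (hF ζ hζ).differentiableAt.differentiableWithinAt
    exact (h1.deriv Metric.isOpen_ball).congr fun ζ hζ => (hF ζ hζ).deriv.symm
  set C := ‖ff p q 0 - 1‖ * (1 + α) / (1 - α) with hC
  have hC0 : 0 ≤ C := div_nonneg (by positivity) (by linarith)
  have hbnd : ∀ ζ ∈ Metric.closedBall (0:ℂ) (α * r), ‖ff p q (Ψ ζ) - 1‖ ≤ C := by
    intro ζ hζ
    have h1 := harnack hr hd (fun z _ => ff_norm p q _) (hsub hζ)
    simp only [hΨ0] at h1
    refine h1.trans ?_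
    have h2 : ‖ζ‖ ≤ α * r := by simpa using hζ
    rw [hC, div_le_div_iff₀ (by linarith) (by linarith), mul_assoc, mul_assoc]
    apply mul_le_mul_of_nonneg_left _ (norm_nonneg _)
    nlinarith
  set ζ : ℂ := ⟨0, β⟩ with hζdef
  have hζn : ‖ζ‖ = α * r := by
    have : ζ = β * Complex.I := by apply Complex.ext <;> simp [hζdef]
    rw [this]; simp [hβ]
  have hζm : ζ ∈ Metric.closedBall (0:ℂ) (α * r) := by simp [hζn]
  have h0m : (0:ℂ) ∈ Metric.closedBall (0:ℂ) (α * r) := by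
    simp; positivity
  -- estimate on F
  have hest1 := (convex_closedBall (0:ℂ) (α * r)).norm_image_sub_le_of_norm_hasDerivWithin_le
    (f := fun w => (⟨u (Ψ w), ψ (Ψ w)⟩ : ℂ) - w) (C := C)
    (fun w hw => ((hF w (hsub hw)).sub (hasDerivAt_id w)).hasDerivWithinAt) hbnd h0m hζm
  have hest2 := (convex_closedBall (0:ℂ) (α * r)).norm_image_sub_le_of_norm_hasDerivWithin_le
    (f := fun w => (⟨(Ψ w).re - A (Ψ w), B (Ψ w) - (Ψ w).im⟩ : ℂ) + w) (C := 2 * C)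
    (fun w hw => ((hG w (hsub hw)).add (hasDerivAt_id w)).hasDerivWithinAt)
    (fun w hw => by
      have e : -(ff p q (Ψ w)) ^ 2 + 1 = -((ff p q (Ψ w) - 1) * (ff p q (Ψ w) + 1)) := by ring
      rw [e, norm_neg, norm_mul, mul_comm]
      have h3 := norm_add_le (ff p q (Ψ w)) 1
      have h4 := ff_norm p q (Ψ w)
      rw [norm_one] at h3
      exact mul_le_mul (by linarith) (hbnd w hw) (norm_nonneg _) (by norm_num)) h0m hζm
  rw [sub_zero ζ, hζn] at hest1 hest2
  obtain ⟨hQm, hQ, -⟩ := hΨ ζ (hsub hζm)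
  set Q := Ψ ζ with hQdef
  have hψ1 : |ψ Q - β| ≤ C * (α * r) := by
    refine le_trans ?_ ((Complex.abs_im_le_norm _).trans hest1)
    simp [hΨ0, hψ0, hζdef]
  have hQre : Q.re + A Q = 0 := by simpa [hΦdef, hζdef] using congrArg Complex.re hQ
  have hQim : Q.im + B Q = β := by simpa [hΦdef, hζdef] using congrArg Complex.im hQ
  have hQζ : ‖ζ - Q‖ ≤ C * (α * r) := by
    have e : ((⟨Q.re - A Q, B Q - Q.im⟩ : ℂ) + ζ) -
        ((⟨(Ψ 0).re - A (Ψ 0), B (Ψ 0) - (Ψ 0).im⟩ : ℂ) + 0) = -2 * starRingEnd ℂ (ζ - Q) := by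
      apply Complex.ext
      · simp [hΨ0, hA0, hζdef]; linarith
      · simp [hΨ0, hB0, hζdef]; linarith
    rw [e, norm_mul, RCLike.norm_conj] at hest2
    simp only [norm_neg, Complex.norm_ofNat] at hest2
    linarith
  have hlip := (convex_ball (0:ℂ) r).norm_image_sub_le_of_norm_hasFDerivWithin_le (C := 1)
    (fun w hw => (hψ w hw).hasFDerivWithinAt)
    (fun w hw => lin_norm_le (by
      have hW := WW_pos p q w
      have hs := WW_sq p q w
      rw [div_pow, div_pow, ← add_div, div_le_one (by positivity)]
      nlinarith)) hQm (hsub hζm)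
  rw [one_mul, Real.norm_eq_abs] at hlip
  have := abs_sub_le (ψ ζ) (ψ Q) β
  linarith

lemma core {r : ℝ} (hr : 0 < r) {u p q : ℂ → ℝ} (h : Sol r u p q) {α : ℝ} (hα : α ∈ Ioo (0:ℝ) 1) :
    |(∫ y in (-(α * r))..(α * r), p ⟨0, y⟩ / WW p q ⟨0, y⟩) - 2 * α * r| ≤
      4 * (‖ff p q 0 - 1‖ * (1 + α) / (1 - α)) * (α * r) := by
  obtain ⟨ψ, hψ0, hψ⟩ := exists_psi h
  have hαr0 : 0 < α * r := mul_pos hα.1 hr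
  have hαr : α * r < r := by nlinarith [hα.2]
  have h1 := core_psi hr h hψ0 hψ hα (β := α * r) (abs_of_pos hαr0)
  have h2 := core_psi hr h hψ0 hψ hα (β := -(α * r)) (by rw [abs_neg, abs_of_pos hαr0])
  have hmem : ∀ y ∈ uIcc (-(α * r)) (α * r), (⟨0, y⟩ : ℂ) ∈ Metric.ball (0:ℂ) r := by
    intro y hy
    rw [uIcc_of_le (by linarith)] at hy
    have : (⟨0, y⟩ : ℂ) = y * Complex.I := by apply Complex.ext <;> simp
    rw [this]
    simp only [Metric.mem_ball, dist_zero_right, norm_mul, Complex.norm_I, mul_one, Complex.norm_real,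
      Real.norm_eq_abs]
    exact (abs_le.2 hy).trans_lt hαr
  have hline : ∀ y : ℝ, HasDerivAt (fun y : ℝ => (⟨0, y⟩ : ℂ)) Complex.I y := by
    intro y
    have h3 := (Complex.ofRealCLM.hasDerivAt (x := y)).mul_const Complex.I
    have e : (fun y : ℝ => (⟨0, y⟩ : ℂ)) = fun y : ℝ => Complex.ofRealCLM y * Complex.I := by
      ext y; apply Complex.ext <;> simp
    rw [e]
    simpa using h3
  have hint : (∫ y in (-(α * r))..(α * r), p ⟨0, y⟩ / WW p q ⟨0, y⟩) =
      ψ ⟨0, α * r⟩ - ψ ⟨0, -(α * r)⟩ := by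
    refine intervalIntegral.integral_eq_sub_of_hasDerivAt (f := fun y => ψ ⟨0, y⟩) ?_ ?_
    · intro y hy
      have h4 := (hψ _ (hmem y hy)).comp_hasDerivAt y (hline y)
      have e : lin (-q ⟨0, y⟩ / WW p q ⟨0, y⟩) (p ⟨0, y⟩ / WW p q ⟨0, y⟩) Complex.I =
          p ⟨0, y⟩ / WW p q ⟨0, y⟩ := by simp [lin_apply]
      rw [e] at h4
      exact h4
    · apply ContinuousOn.intervalIntegrable
      intro y hy
      obtain ⟨-, R, S, T, hp, hq, -⟩ := h _ (hmem y hy)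
      have h5 := (lin_mul hp (WW_deriv hp hq)).continuousAt
      exact (ContinuousAt.comp (f := fun y : ℝ => (⟨0, y⟩ : ℂ)) h5
        (hline y).continuousAt).continuousWithinAt
  rw [hint]
  have : ψ ⟨0, α * r⟩ - ψ ⟨0, -(α * r)⟩ - 2 * α * r =
    (ψ ⟨0, α * r⟩ - α * r) - (ψ ⟨0, -(α * r)⟩ - -(α * r)) := by ring
  rw [this]
  have := abs_sub (ψ ⟨0, α * r⟩ - α * r) (ψ ⟨0, -(α * r)⟩ - -(α * r))
  linarith

lemma isOpen_eball (r : ℝ) : IsOpen (eball 0 r) := by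
  unfold eball len
  exact isOpen_lt (by fun_prop) continuous_const

lemma mem_eball_iff {r : ℝ} {z : ℂ} : (z.re, z.im) ∈ eball 0 r ↔ z ∈ Metric.ball (0:ℂ) r := by
  simp [eball, len, Complex.norm_def, Complex.normSq_apply, sq]

lemma pd1_eq {u : ℝ × ℝ → ℝ} {L : ℝ × ℝ →L[ℝ] ℝ} {z : ℝ × ℝ} (h : HasFDerivAt u L z) :
    pd1 u z = L (1, 0) := by
  have h1 : HasDerivAt (fun t : ℝ => (t, z.2)) ((1:ℝ), (0:ℝ)) z.1 :=
    (hasDerivAt_id _).prodMk (hasDerivAt_const _ _)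
  exact (HasFDerivAt.comp_hasDerivAt (f := fun t : ℝ => (t, z.2)) z.1 h h1).deriv

lemma pd2_eq {u : ℝ × ℝ → ℝ} {L : ℝ × ℝ →L[ℝ] ℝ} {z : ℝ × ℝ} (h : HasFDerivAt u L z) :
    pd2 u z = L (0, 1) := by
  have h1 : HasDerivAt (fun t : ℝ => (z.1, t)) ((0:ℝ), (1:ℝ)) z.2 :=
    (hasDerivAt_const _ _).prodMk (hasDerivAt_id _)
  exact (HasFDerivAt.comp_hasDerivAt (f := fun t : ℝ => (z.1, t)) z.2 h h1).deriv

lemma lift_deriv {u : ℝ × ℝ → ℝ} {L : ℝ × ℝ →L[ℝ] ℝ} {z : ℂ} (h : HasFDerivAt u L (z.re, z.im)) :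
    HasFDerivAt (fun w : ℂ => u (w.re, w.im)) (lin (L (1, 0)) (L (0, 1))) z := by
  have h1 : HasFDerivAt (fun w : ℂ => (w.re, w.im)) (Complex.reCLM.prod Complex.imCLM) z :=
    Complex.reCLM.hasFDerivAt.prodMk Complex.imCLM.hasFDerivAt
  have h2 := HasFDerivAt.comp (f := fun w : ℂ => (w.re, w.im)) z h h1
  convert! h2 using 1
  ext v
  have e : ((v.re, v.im) : ℝ × ℝ) = v.re • (1, 0) + v.im • (0, 1) := by simp
  simp only [lin_apply, ContinuousLinearMap.comp_apply, ContinuousLinearMap.prod_apply,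
    Complex.reCLM_apply, Complex.imCLM_apply]
  rw [e, map_add, map_smul, map_smul]

lemma sol_of_isMSE {r : ℝ} {u : ℝ × ℝ → ℝ} (h : IsMSE u (eball 0 r)) :
    Sol r (fun z => u (z.re, z.im)) (fun z => pd1 u (z.re, z.im)) (fun z => pd2 u (z.re, z.im)) := by
  intro z hz
  obtain ⟨hc, hE⟩ := h
  have hz' := mem_eball_iff.2 hz
  have hE := hE _ hz'
  set x : ℝ × ℝ := (z.re, z.im) with hx
  have hcd : ∀ y ∈ eball 0 r, ContDiffAt ℝ 2 u y := fun y hy =>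
    hc.contDiffAt ((isOpen_eball r).mem_nhds hy)
  have hu : ∀ y ∈ eball 0 r, HasFDerivAt u (fderiv ℝ u y) y := fun y hy =>
    ((hcd y hy).differentiableAt (by norm_num)).hasFDerivAt
  have hD : HasFDerivAt (fderiv ℝ u) (fderiv ℝ (fderiv ℝ u) x) x :=
    (((hcd x hz').fderiv_right (m := 1) (by norm_num)).differentiableAt (by norm_num)).hasFDerivAt
  have hnear : ∀ᶠ y in 𝓝 x, y ∈ eball 0 r := (isOpen_eball r).mem_nhds hz'
  set D := fderiv ℝ (fderiv ℝ u) x with hDdef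
  have hp : HasFDerivAt (pd1 u) (D.flip (1, 0)) x := by
    have h1 : HasFDerivAt (fun y => fderiv ℝ u y (1, 0)) (D.flip (1, 0)) x := by
      convert! hD.clm_apply (hasFDerivAt_const ((1:ℝ), (0:ℝ)) x) using 1
      ext <;> simp
    refine h1.congr_of_eventuallyEq ?_
    filter_upwards [hnear] with y hy using pd1_eq (hu y hy)
  have hq : HasFDerivAt (pd2 u) (D.flip (0, 1)) x := by
    have h1 : HasFDerivAt (fun y => fderiv ℝ u y (0, 1)) (D.flip (0, 1)) x := by
      convert! hD.clm_apply (hasFDerivAt_const ((0:ℝ), (1:ℝ)) x) using 1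
      ext <;> simp
    refine h1.congr_of_eventuallyEq ?_
    filter_upwards [hnear] with y hy using pd2_eq (hu y hy)
  have hsym : D (1, 0) (0, 1) = D (0, 1) (1, 0) :=
    ((hcd x hz').isSymmSndFDerivAt (by simp)) (1, 0) (0, 1)
  refine ⟨?_, D (1, 0) (1, 0), D (0, 1) (1, 0), D (0, 1) (0, 1), ?_, ?_, ?_⟩
  · have := lift_deriv (hu x hz')
    rwa [← pd1_eq (hu x hz'), ← pd2_eq (hu x hz')] at this
  · simpa using lift_deriv hp
  · have := lift_deriv hq
    simp only [ContinuousLinearMap.flip_apply] at this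
    rwa [hsym] at this
  · rw [pd1_eq hp, pd2_eq hp, pd2_eq hq] at hE
    exact hE

/-- If the downward normals at the origin of a sequence of solutions of the minimal
surfaces equation on the Euclidean disk `D(0,r)` converge to `(1,0,0)`, then for every
`α ∈ (0,1)` the flux integrals `∫_{−αr}^{αr} (pₙ/Wₙ)(0,y) dy` converge to `2αr`,
i.e. `pₙ/Wₙ(0,·) → 1` in `L¹([−αr, αr])`. -/
theorem flux_integral_tendsto
    (r : ℝ) (hr : 0 < r)
    (u : ℕ → ℝ × ℝ → ℝ) (hu : ∀ n, IsMSE (u n) (eball 0 r))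
    (hN0 : Tendsto (fun n => Nvec (u n) 0) atTop (𝓝 (1, 0, 0))) :
    ∀ α ∈ Ioo (0:ℝ) 1,
      Tendsto (fun n => ∫ y in (-(α * r))..(α * r), pd1 (u n) (0, y) / Wg (u n) (0, y))
        atTop (𝓝 (2 * α * r)) := by

  intro α hα
  have hff : Tendsto (fun n => ‖ff (fun z => pd1 (u n) (z.re, z.im)) (fun z => pd2 (u n) (z.re, z.im)) 0 - 1‖)
      atTop (𝓝 0) := by
    have hc : ContinuousAt (fun v : ℝ × ℝ × ℝ =>
        ‖((v.1 / (1 - v.2.2) : ℝ) + (-v.2.1 / (1 - v.2.2) : ℝ) * Complex.I : ℂ) - 1‖) (1, 0, 0) := by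
      have : (1 - ((1:ℝ), (0:ℝ), (0:ℝ)).2.2) ≠ 0 := by simp
      fun_prop (disch := exact this)
    have ht := hc.tendsto.comp hN0
    simp only [sub_zero, div_one, neg_zero, zero_mul, Complex.ofReal_zero, Complex.ofReal_one,
      add_zero, sub_self, norm_zero] at ht
    refine ht.congr fun n => ?_
    simp only [Function.comp]
    congr 2
    have hW : 0 < Wg (u n) 0 := Real.sqrt_pos.2 (by positivity)
    have e : WW (fun z => pd1 (u n) (z.re, z.im)) (fun z => pd2 (u n) (z.re, z.im)) 0 = Wg (u n) 0 := rfl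
    have e0 : (((0:ℂ).re, (0:ℂ).im) : ℝ × ℝ) = 0 := rfl
    rw [← Complex.mk_eq_add_mul_I]
    unfold ff
    rw [e]
    simp only [Nvec, e0]
    have hD : 1 - -1 / Wg (u n) 0 = (1 + Wg (u n) 0) / Wg (u n) 0 := by field_simp; ring
    rw [hD]
    congr 1 <;> field_simp
  rw [tendsto_iff_norm_sub_tendsto_zero]
  refine squeeze_zero (fun _ => norm_nonneg _) (fun n => core hr (sol_of_isMSE (hu n)) hα) ?_
  have := ((hff.mul_const ((1 + α))).div_const (1 - α)).const_mul 4 |>.mul_const (α * r)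
  simpa using this
end

section
/- Let Ω ⊆ ℝ² be an open connected set and (u_n) a sequence of C² solutions of the minimal surfaces equation on Ω. Let P ∈ Ω and let v ∈ ℝ² be a unit vector, and let D be the connected component containing P of the intersection of Ω with the straight line through P orthogonal to v (the geodesic of Ω through P normal to v). If the downward unit normals N_n(P) converge to the horizontal vector N = (v₁, v₂, 0), then N_n(Q) converges to N for every point Q ∈ D. -/
open Real Filter Set Topology MeasureTheory

namespace LoD
open Complex ComplexConjugate

/-- `d ↦ 2 (d + G conj d) / (1 - |G|²)`. -/
noncomputable def AA (G : ℂ) : ℂ →L[ℝ] ℂ :=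
  (2 / (1 - ‖G‖ ^ 2) : ℝ) • (ContinuousLinearMap.id ℝ ℂ + G • (Complex.conjCLE : ℂ →L[ℝ] ℂ))

/-- `d ↦ (d - G conj d) / 2`, the inverse of `AA G`. -/
noncomputable def KK (G : ℂ) : ℂ →L[ℝ] ℂ :=
  (1 / 2 : ℝ) • (ContinuousLinearMap.id ℝ ℂ - G • (Complex.conjCLE : ℂ →L[ℝ] ℂ))

lemma AA_apply (G d : ℂ) : AA G d = (2 / (1 - ‖G‖ ^ 2) : ℝ) * (d + G * conj d) := by
  simp [AA]; ring

lemma KK_apply (G d : ℂ) : KK G d = (d - G * conj d) / 2 := by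
  simp [KK]; ring

lemma one_sub_pos {G : ℂ} (h : ‖G‖ < 1) : 0 < 1 - ‖G‖ ^ 2 := by
  nlinarith [norm_nonneg G]

lemma AA_KK {G : ℂ} (h : ‖G‖ < 1) (d : ℂ) : AA G (KK G d) = d := by
  have h1 : ((1 - ‖G‖ ^ 2 : ℝ) : ℂ) ≠ 0 := by exact_mod_cast (one_sub_pos h).ne'
  have h2 : ((‖G‖ ^ 2 : ℝ) : ℂ) = G * conj G := by
    rw [Complex.mul_conj, Complex.normSq_eq_norm_sq]
  rw [AA_apply, KK_apply]
  push_cast at h1 h2 ⊢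
  rw [h2] at h1 ⊢
  simp only [map_div₀, map_sub, map_mul, Complex.conj_conj, map_ofNat]
  field_simp
  ring

lemma KK_AA {G : ℂ} (h : ‖G‖ < 1) (d : ℂ) : KK G (AA G d) = d := by
  have h1 : ((1 - ‖G‖ ^ 2 : ℝ) : ℂ) ≠ 0 := by exact_mod_cast (one_sub_pos h).ne'
  have h2 : ((‖G‖ ^ 2 : ℝ) : ℂ) = G * conj G := by
    rw [Complex.mul_conj, Complex.normSq_eq_norm_sq]
  rw [AA_apply, KK_apply]
  simp only [map_mul, Complex.conj_ofReal, map_add, Complex.conj_conj]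
  push_cast at h1 h2 ⊢
  rw [h2] at h1 ⊢
  field_simp
  ring

noncomputable def AE (G : ℂ) (h : ‖G‖ < 1) : ℂ ≃L[ℝ] ℂ :=
  ContinuousLinearEquiv.equivOfInverse (AA G) (KK G) (KK_AA h) (AA_KK h)

lemma inner_AA {G : ℂ} (h : ‖G‖ < 1) (d : ℂ) : ‖d‖ ^ 2 ≤ inner ℝ d (AA G d) := by
  have h1 := one_sub_pos h
  have h3 : inner ℝ d (AA G d) = 2 / (1 - ‖G‖ ^ 2) * (‖d‖ ^ 2 + (G * conj d ^ 2).re) := by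
    rw [Complex.inner, AA_apply, mul_assoc, Complex.re_ofReal_mul]
    congr 1
    rw [add_mul, Complex.add_re, Complex.mul_conj, Complex.ofReal_re,
      Complex.normSq_eq_norm_sq, show G * conj d * conj d = G * conj d ^ 2 by ring]
  have h4 : -(‖G‖ * ‖d‖ ^ 2) ≤ (G * conj d ^ 2).re := by
    have := Complex.abs_re_le_norm (G * conj d ^ 2)
    rw [norm_mul, norm_pow, RCLike.norm_conj] at this
    exact (abs_le.mp this).1
  rw [h3, div_mul_eq_mul_div, le_div_iff₀ h1]
  nlinarith [norm_nonneg G, sq_nonneg ‖d‖, mul_nonneg (mul_nonneg (sub_nonneg.2 h.le) (sub_nonneg.2 h.le)) (sq_nonneg ‖d‖)]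

lemma inner_KK (G d : ℂ) : inner ℝ d (KK G d) = (‖d‖ ^ 2 - (conj G * d ^ 2).re) / 2 := by
  have : (conj G * d ^ 2).re = (G * conj d ^ 2).re := by
    rw [← Complex.conj_re]; simp
  rw [this, Complex.inner, KK_apply, ← Complex.normSq_eq_norm_sq,
    ← Complex.ofReal_re (Complex.normSq d), Complex.normSq_eq_conj_mul_self, ← Complex.sub_re,
    show (d - G * conj d) / 2 * conj d = ((1/2 : ℝ) : ℂ) * (conj d * d - G * conj d ^ 2) by
      push_cast; ring, Complex.re_ofReal_mul]
  ring

/-- `T` is expanding. -/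
lemma T_mono {z0 : ℂ} {R : ℝ} {G T : ℂ → ℂ} (hG : ∀ z ∈ Metric.ball z0 R, ‖G z‖ < 1)
    (hT : ∀ z ∈ Metric.ball z0 R, HasFDerivAt T (AA (G z)) z) {x y : ℂ}
    (hx : x ∈ Metric.ball z0 R) (hy : y ∈ Metric.ball z0 R) :
    ‖x - y‖ ^ 2 ≤ inner ℝ (x - y) (T x - T y) := by
  have hseg : ∀ t ∈ Icc (0:ℝ) 1, y + t • (x - y) ∈ Metric.ball z0 R := fun t ht =>
    (convex_ball z0 R).add_smul_sub_mem hy hx ht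
  have hd : ∀ t ∈ Icc (0:ℝ) 1, HasDerivAt (fun t : ℝ => inner ℝ (x - y) (T (y + t • (x - y))))
      (inner ℝ (x - y) (AA (G (y + t • (x - y))) (x - y))) t := by
    intro t ht
    have h1 : HasDerivAt (fun t : ℝ => y + t • (x - y)) (x - y) t := by
      simpa using ((hasDerivAt_id t).smul_const (x - y)).const_add y
    have h2 := (hT _ (hseg t ht)).comp_hasDerivAt t h1
    simpa using (hasDerivAt_const t (x - y)).inner ℝ h2
  obtain ⟨t, ht, h⟩ := exists_hasDerivAt_eq_slope
    (fun t : ℝ => inner ℝ (x - y) (T (y + t • (x - y)))) _ zero_lt_one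
    (fun t ht => (hd t ht).continuousAt.continuousWithinAt)
    (fun t ht => hd t (Ioo_subset_Icc_self ht))
  have := inner_AA (hG _ (hseg t (Ioo_subset_Icc_self ht))) (x - y)
  rw [h] at this
  simpa [inner_sub_right] using this

lemma T_expand {z0 : ℂ} {R : ℝ} {G T : ℂ → ℂ} (hG : ∀ z ∈ Metric.ball z0 R, ‖G z‖ < 1)
    (hT : ∀ z ∈ Metric.ball z0 R, HasFDerivAt T (AA (G z)) z) {x y : ℂ}
    (hx : x ∈ Metric.ball z0 R) (hy : y ∈ Metric.ball z0 R) :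
    ‖x - y‖ ≤ ‖T x - T y‖ := by
  have h1 := T_mono hG hT hx hy
  have h2 := real_inner_le_norm (x - y) (T x - T y)
  rcases (norm_nonneg (x - y)).eq_or_lt with h | h
  · rw [← h]; positivity
  · nlinarith

lemma T_surj {z0 : ℂ} {R : ℝ} {G T : ℂ → ℂ} (hG : ∀ z ∈ Metric.ball z0 R, ‖G z‖ < 1)
    (hT : ∀ z ∈ Metric.ball z0 R, HasFDerivAt T (AA (G z)) z) {x : ℂ} {ρ : ℝ} (hρ : 0 < ρ)
    (hx : Metric.closedBall x (2 * ρ) ⊆ Metric.ball z0 R) :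
    Metric.ball (T x) ρ ⊆ T '' Metric.ball z0 R := by
  intro z hz
  have hxx : x ∈ Metric.closedBall x (2 * ρ) := Metric.mem_closedBall_self (by positivity)
  have hcont : ContinuousOn (fun y => ‖T y - z‖ ^ 2) (Metric.closedBall x (2 * ρ)) := fun y hy =>
    (((hT y (hx hy)).continuousAt.sub continuousAt_const).norm.pow 2).continuousWithinAt
  obtain ⟨y, hy, hmin⟩ := (isCompact_closedBall x (2 * ρ)).exists_isMinOn ⟨x, hxx⟩ hcont
  have hzx : ‖T x - z‖ < ρ := by rw [← dist_eq_norm, dist_comm]; exact hz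
  have hle : ‖T y - z‖ ≤ ‖T x - z‖ := by
    have := hmin hxx
    simp only [mem_ofPred_eq] at this
    exact (sq_le_sq₀ (norm_nonneg _) (norm_nonneg _)).1 this
  have hyb : y ∈ Metric.ball x (2 * ρ) := by
    rw [Metric.mem_ball, dist_eq_norm]
    calc ‖y - x‖ ≤ ‖T y - T x‖ := T_expand hG hT (hx hy) (hx hxx)
      _ ≤ ‖T y - z‖ + ‖T x - z‖ := by
        rw [← norm_neg (T x - z), show T y - T x = (T y - z) + -(T x - z) by ring]
        exact norm_add_le _ _
      _ < 2 * ρ := by linarith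
  have hloc : IsLocalMin (fun y => ‖T y - z‖ ^ 2) y :=
    hmin.isLocalMin (mem_of_superset (Metric.isOpen_ball.mem_nhds hyb) Metric.ball_subset_closedBall)
  have hder : HasFDerivAt (fun y => ‖T y - z‖ ^ 2) _ y := ((hT y (hx hy)).sub_const z).norm_sq
  have h0 := hloc.hasFDerivAt_eq_zero hder
  have h1 := congrArg (fun l : ℂ →L[ℝ] ℝ => l (T y - z)) h0
  simp at h1
  have h2 := inner_AA (hG y (hx hy)) (T y - z)
  have h3 : inner ℝ (T y - z) ((AA (G y)) (T y - z)) = 0 := by simpa [inner_sub_left] using h1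
  have h4 : ‖T y - z‖ = 0 := by
    have : ‖T y - z‖ ^ 2 = 0 := le_antisymm (by linarith) (by positivity)
    simpa using this
  exact ⟨y, hx hy, by simpa [sub_eq_zero] using h4⟩

/-- All the facts about the inverse of `T`. -/
lemma exists_S {z0 : ℂ} {R : ℝ} {G T : ℂ → ℂ} (hG : ∀ z ∈ Metric.ball z0 R, ‖G z‖ < 1)
    (hT : ∀ z ∈ Metric.ball z0 R, HasFDerivAt T (AA (G z)) z) :
    ∃ (V : Set ℂ) (S Φ : ℂ → ℂ), IsOpen V ∧
      (∀ x ρ, 0 < ρ → Metric.closedBall x (2 * ρ) ⊆ Metric.ball z0 R → Metric.ball (T x) ρ ⊆ V) ∧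
      (∀ x ∈ Metric.ball z0 R, S (T x) = x ∧ Φ (T x) = conj (G x)) ∧
      (∀ X ∈ V, ‖Φ X‖ < 1) ∧
      DifferentiableOn ℂ Φ V ∧
      (∀ X ∈ V, HasFDerivAt S (KK (conj (Φ X))) X) ∧
      (∀ X ∈ V, ∀ Y ∈ V, 0 ≤ inner ℝ (X - Y) (S X - S Y)) := by
  set B := Metric.ball z0 R
  have hinj : InjOn T B := by
    intro x hx y hy h
    have := T_expand hG hT hx hy
    rw [h, sub_self, norm_zero] at this
    simpa [sub_eq_zero] using this
  set S := Function.invFunOn T B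
  have hS : ∀ x ∈ B, S (T x) = x := fun x hx => hinj.leftInvOn_invFunOn hx
  have hopen : IsOpen (T '' B) := by
    rw [Metric.isOpen_iff]
    rintro _ ⟨x, hx, rfl⟩
    obtain ⟨ε, hε, h⟩ := Metric.isOpen_iff.1 (Metric.isOpen_ball (x := z0) (ε := R)) x hx
    refine ⟨ε / 4, by positivity, T_surj hG hT (by positivity) (Subset.trans ?_ h)⟩
    exact Metric.closedBall_subset_ball (by linarith)
  have hSd : ∀ X ∈ T '' B, HasFDerivAt S (KK (G (S X))) X := by
    rintro _ ⟨x, hx, rfl⟩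
    have hc : ContinuousAt S (T x) := by
      rw [Metric.continuousAt_iff]
      intro ε hε
      obtain ⟨δ, hδ, h⟩ := Metric.isOpen_iff.1 hopen (T x) ⟨x, hx, rfl⟩
      refine ⟨min δ ε, by positivity, fun {y} hy => ?_⟩
      obtain ⟨y, hyB, rfl⟩ := h (lt_of_lt_of_le hy (min_le_left _ _) : dist y (T x) < δ)
      rw [hS x hx, hS y hyB, dist_eq_norm]
      refine lt_of_le_of_lt (T_expand hG hT hyB hx) ?_
      rw [← dist_eq_norm]
      exact lt_of_lt_of_le hy (min_le_right _ _)
    have hf : HasFDerivAt T ((AE (G x) (hG x hx) : ℂ ≃L[ℝ] ℂ) : ℂ →L[ℝ] ℂ) (S (T x)) := by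
      rw [hS x hx]; exact hT x hx
    have := HasFDerivAt.of_local_left_inverse hc hf (by
      filter_upwards [hopen.mem_nhds ⟨x, hx, rfl⟩]
      rintro _ ⟨y, hy, rfl⟩
      rw [hS y hy])
    rw [hS x hx]
    exact this
  have hH : ∀ X ∈ T '' B, HasDerivAt (fun X => conj (X - 2 * S X)) (conj (G (S X))) X := by
    intro X hX
    have h1 : HasFDerivAt (fun X => conj (X - 2 * S X)) _ X :=
      (Complex.conjCLE : ℂ →L[ℝ] ℂ).hasFDerivAt.comp X
        ((hasFDerivAt_id X).sub ((hSd X hX).const_mul 2))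
    rw [hasDerivAt_iff_hasFDerivAt]
    refine hasFDerivAt_of_restrictScalars ℝ h1 ?_
    ext1 d
    simp [KK_apply]
    rw [map_ofNat]
    ring
  have hΦ : DifferentiableOn ℂ (fun X => conj (G (S X))) (T '' B) := by
    have h1 : DifferentiableOn ℂ (fun X => conj (X - 2 * S X)) (T '' B) := fun X hX =>
      (hH X hX).differentiableAt.differentiableWithinAt
    refine (h1.deriv hopen).congr fun X hX => (hH X hX).deriv.symm
  refine ⟨T '' B, S, fun X => conj (G (S X)), hopen, fun x ρ h1 h2 => T_surj hG hT h1 h2,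
    fun x hx => ⟨hS x hx, by simp only [hS x hx]⟩, ?_, hΦ, ?_, ?_⟩
  · rintro _ ⟨x, hx, rfl⟩
    rw [RCLike.norm_conj, hS x hx]; exact hG x hx
  · intro X hX
    simpa using hSd X hX
  · rintro _ ⟨x, hx, rfl⟩ _ ⟨y, hy, rfl⟩
    rw [hS x hx, hS y hy, real_inner_comm]
    exact le_trans (by positivity) (T_mono hG hT hx hy)

/-- Harnack-type inequality for holomorphic functions with positive real part. -/
lemma harnack {h : ℂ → ℂ} {a z : ℂ} {ρ : ℝ} (hρ : 0 < ρ)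
    (hd : DifferentiableOn ℂ h (Metric.ball a ρ))
    (hpos : ∀ z ∈ Metric.ball a ρ, 0 < (h z).re) (hz : ‖z - a‖ ≤ ρ / 2) :
    ‖h z‖ ≤ 3 * ‖h a‖ := by
  have haB : a ∈ Metric.ball a ρ := Metric.mem_ball_self hρ
  have hzB : z ∈ Metric.ball a ρ := by rw [Metric.mem_ball, dist_eq_norm]; linarith
  have hne : ∀ z ∈ Metric.ball a ρ, h z + conj (h a) ≠ 0 := by
    intro z hz h0
    have := congrArg Complex.re h0
    simp at this
    linarith [hpos z hz, hpos a haB]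
  set k : ℂ → ℂ := fun z => (h z - h a) / (h z + conj (h a)) with hk
  have hka : k a = 0 := by simp [hk]
  have hkd : DifferentiableOn ℂ k (Metric.ball a ρ) :=
    (hd.sub_const _).div (hd.add_const _) hne
  have hmaps : MapsTo k (Metric.ball a ρ) (Metric.closedBall (k a) 1) := by
    intro z hz
    rw [hka, mem_closedBall_zero_iff, hk]
    simp only [norm_div]
    refine div_le_one_of_le₀ ?_ (norm_nonneg _)
    refine (sq_le_sq₀ (norm_nonneg _) (norm_nonneg _)).1 ?_
    rw [← Complex.normSq_eq_norm_sq, ← Complex.normSq_eq_norm_sq, Complex.normSq_apply,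
      Complex.normSq_apply]
    simp
    nlinarith [mul_pos (hpos z hz) (hpos a haB)]
  have h1 := Complex.dist_le_div_mul_dist_of_mapsTo_ball hkd hmaps hzB
  rw [hka, dist_zero_right, dist_eq_norm] at h1
  have h2 : ‖k z‖ ≤ 1 / 2 := by
    refine h1.trans ?_
    rw [div_mul_eq_mul_div, one_mul, div_le_iff₀ hρ]; linarith
  have h3 : h z - h a = k z * (h z + conj (h a)) := by
    simp only [hk]; rw [div_mul_cancel₀ _ (hne z hzB)]
  have h4 : ‖h z - h a‖ ≤ 1 / 2 * (‖h z‖ + ‖h a‖) := by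
    rw [h3, norm_mul]
    refine mul_le_mul h2 ((norm_add_le _ _).trans ?_) (norm_nonneg _) (by norm_num)
    rw [RCLike.norm_conj]
  have h5 := norm_sub_norm_le (h z) (h a)
  linarith

lemma norm_one_sub_sq {w : ℂ} (hw : ‖w‖ ≤ 1) : ‖1 - w‖ ^ 2 ≤ 2 * (1 - w.re) := by
  have : ‖w‖ ^ 2 ≤ 1 := by nlinarith [norm_nonneg w]
  rw [← Complex.normSq_eq_norm_sq, Complex.normSq_apply] at *
  simp
  nlinarith


lemma S_mvt {V : Set ℂ} {S Φ : ℂ → ℂ} (hS : ∀ X ∈ V, HasFDerivAt S (KK (conj (Φ X))) X)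
    {X d : ℂ} {τ : ℝ} (hτ : 0 < τ) (hd : ‖d‖ = 1) (hV : ∀ t ∈ Icc (0:ℝ) τ, X + t * d ∈ V) :
    ∃ t ∈ Icc (0:ℝ) τ, inner ℝ d (S (X + τ * d) - S X)
      = τ * (1 - (Φ (X + t * d) * d ^ 2).re) / 2 := by
  have hder : ∀ t ∈ Icc (0:ℝ) τ, HasDerivAt (fun t : ℝ => inner ℝ d (S (X + t * d)))
      ((1 - (Φ (X + t * d) * d ^ 2).re) / 2) t := by
    intro t ht
    have h1 : HasDerivAt (fun t : ℝ => X + t * d) d t := by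
      simpa using ((Complex.ofRealCLM.hasDerivAt (x := t)).mul_const d).const_add X
    have h2 := (hS _ (hV t ht)).comp_hasDerivAt t h1
    have h3 := (hasDerivAt_const t d).inner ℝ h2
    rw [inner_KK, hd] at h3
    simpa using h3
  obtain ⟨t, ht, h⟩ := exists_hasDerivAt_eq_slope
    (fun t : ℝ => inner ℝ d (S (X + t * d))) _ hτ
    (fun t ht => (hder t ht).continuousAt.continuousWithinAt)
    (fun t ht => hder t (Ioo_subset_Icc_self ht))
  refine ⟨t, Ioo_subset_Icc_self ht, ?_⟩
  rw [mul_div_assoc, h, inner_sub_right]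
  simp
  field_simp

lemma re_one_sub_pos {w : ℂ} (hw : ‖w‖ < 1) : 0 < (1 - w).re := by
  have := (abs_lt.1 ((Complex.abs_re_le_norm w).trans_lt hw)).2
  simp; linarith

lemma main_est {z0 : ℂ} {R : ℝ} {G T : ℂ → ℂ} (hR : 0 < R)
    (hG : ∀ z ∈ Metric.ball z0 R, ‖G z‖ < 1)
    (hT : ∀ z ∈ Metric.ball z0 R, HasFDerivAt T (AA (G z)) z)
    {v : ℂ} (hv : ‖v‖ = 1) {δ : ℝ} (hδ : ‖G z0 - v ^ 2‖ ≤ δ) {s : ℝ} (hs : |s| ≤ R / 16) :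
    ‖G (z0 + s * (I * v)) - v ^ 2‖ ≤ 3 * δ + 4 * √(12 * δ) := by
  obtain ⟨V, S, Φ, hVo, hVb, hST, hΦ1, hΦd, hSd, hSm⟩ := exists_S hG hT
  have hδ0 : 0 ≤ δ := (norm_nonneg _).trans hδ
  have hvv : v * conj v = 1 := by
    rw [Complex.mul_conj, Complex.normSq_eq_norm_sq, hv]; simp
  have hz0 : z0 ∈ Metric.ball z0 R := Metric.mem_ball_self hR
  set e : ℂ := I * v with he
  have hen : ‖e‖ = 1 := by simp [he, hv]
  set Q : ℂ := z0 + s * e with hQ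
  have hsn : ‖(s : ℂ) * e‖ = |s| := by rw [norm_mul, hen, mul_one, Complex.norm_real, Real.norm_eq_abs]
  have hQ0 : ‖Q - z0‖ ≤ R / 16 := by rw [hQ, add_sub_cancel_left, hsn]; exact hs
  have hQB : Q ∈ Metric.ball z0 R := by rw [Metric.mem_ball, dist_eq_norm]; linarith
  -- transfer between `G` and `Φ`
  have htr : ∀ w : ℂ, ‖w - conj v ^ 2‖ = ‖1 - v ^ 2 * w‖ := by
    intro w
    have : 1 - v ^ 2 * w = - (v ^ 2 * (w - conj v ^ 2)) := by
      linear_combination (-(1 + v * conj v)) * hvv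
    rw [this, norm_neg, norm_mul, norm_pow, hv]; simp
  have htr2 : ∀ w : ℂ, ‖conj w - conj v ^ 2‖ = ‖w - v ^ 2‖ := by
    intro w
    rw [← map_pow, ← map_sub, RCLike.norm_conj]
  have hV0 : Metric.ball (T z0) (R / 4) ⊆ V := hVb z0 (R / 4) (by positivity)
    (Metric.closedBall_subset_ball (by linarith))
  have hVQ : Metric.ball (T Q) (R / 4) ⊆ V := by
    refine hVb Q (R / 4) (by positivity) fun y hy => ?_
    rw [Metric.mem_closedBall, dist_eq_norm] at hy
    rw [Metric.mem_ball, dist_eq_norm]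
    have := norm_add_le (y - Q) (Q - z0)
    rw [sub_add_sub_cancel] at this
    linarith
  -- closeness on a ball about `T z0`
  have hclose : ∀ Z, ‖Z - T z0‖ ≤ R / 8 → ‖Φ Z - conj v ^ 2‖ ≤ 3 * δ := by
    intro Z hZ
    have h1 := harnack (h := fun X => 1 - v ^ 2 * Φ X) (a := T z0) (z := Z) (ρ := R / 4)
      (by positivity) (((hΦd.mono hV0).const_mul _).const_sub _)
      (fun X hX => re_one_sub_pos (by rw [norm_mul, norm_pow, hv]; simpa using hΦ1 X (hV0 hX)))
      (by linarith)
    simp only [← htr] at h1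
    rw [(hST z0 hz0).2, htr2] at h1
    linarith
  set X : ℂ := T z0 + s * e with hX
  have hX0 : ‖X - T z0‖ ≤ R / 16 := by rw [hX, add_sub_cancel_left, hsn]; exact hs
  -- `S X` is close to `Q`
  have hSX : ‖S X - Q‖ ≤ 3 * δ / 2 * (R / 16) := by
    have hder : ∀ t ∈ Metric.closedBall (0:ℝ) (R / 16),
        HasDerivWithinAt (fun t : ℝ => S (T z0 + t * e) - t * e)
          (KK (conj (Φ (T z0 + t * e))) e - e) (Metric.closedBall (0:ℝ) (R / 16)) t := by
      intro t ht
      have h0 : HasDerivAt (fun t : ℝ => (t : ℂ) * e) e t := by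
        simpa using ((Complex.ofRealCLM.hasDerivAt (x := t)).mul_const e)
      have ht' : T z0 + t * e ∈ V := by
        apply hV0
        rw [Metric.mem_ball, dist_eq_norm, add_sub_cancel_left, norm_mul, hen, mul_one,
          Complex.norm_real]
        rw [mem_closedBall_zero_iff] at ht
        linarith
      exact (((hSd _ ht').comp_hasDerivAt t (h0.const_add (T z0))).sub h0).hasDerivWithinAt
    have hbd : ∀ t ∈ Metric.closedBall (0:ℝ) (R / 16),
        ‖KK (conj (Φ (T z0 + t * e))) e - e‖ ≤ 3 * δ / 2 := by
      intro t ht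
      rw [mem_closedBall_zero_iff] at ht
      have h1 := hclose (T z0 + t * e) (by
        rw [add_sub_cancel_left, norm_mul, hen, mul_one, Complex.norm_real]
        linarith)
      rw [← RCLike.norm_conj, map_sub, map_pow, Complex.conj_conj] at h1
      have h2 : KK (conj (Φ (T z0 + t * e))) e - e
          = (I * conj v / 2) * (conj (Φ (T z0 + t * e)) - v ^ 2) := by
        rw [KK_apply, he]
        simp only [map_mul, Complex.conj_I]
        linear_combination (I * v / 2) * hvv
      rw [h2, norm_mul, norm_div, norm_mul, RCLike.norm_conj, hv]
      simp
      linarith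
    have h3 := (convex_closedBall (0:ℝ) (R / 16)).norm_image_sub_le_of_norm_hasDerivWithin_le
      hder hbd (x := 0) (y := s) (Metric.mem_closedBall_self (by positivity))
      (by rw [mem_closedBall_zero_iff]; exact hs)
    simp only [Complex.ofReal_zero, zero_mul, add_zero, sub_zero, (hST z0 hz0).1] at h3
    rw [show S X - Q = S (T z0 + s * e) - s * e - z0 by rw [hX, hQ]; ring]
    refine h3.trans ?_
    rw [Real.norm_eq_abs]
    exact mul_le_mul_of_nonneg_left hs (by positivity)
  set Y : ℂ := T Q with hY
  have hgoal : ‖G Q - v ^ 2‖ = ‖Φ Y - conj v ^ 2‖ := by rw [(hST Q hQB).2, htr2]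
  rw [hgoal]
  have hsq0 : 0 ≤ √(12 * δ) := Real.sqrt_nonneg _
  rcases le_or_gt ‖X - Y‖ (R / 16) with hXY | hXY
  · have := hclose Y (by
      have := norm_add_le (Y - X) (X - T z0)
      rw [sub_add_sub_cancel, norm_sub_rev Y X] at this
      linarith)
    linarith
  have hXYpos : 0 < ‖X - Y‖ := lt_trans (by positivity) hXY
  set L : ℝ := ‖X - Y‖ with hL
  set d : ℂ := (X - Y) / L with hd
  have hLc : (L : ℂ) ≠ 0 := by exact_mod_cast hXYpos.ne'
  have hdn : ‖d‖ = 1 := by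
    rw [hd, norm_div, Complex.norm_real, Real.norm_of_nonneg hXYpos.le, ← hL, div_self hXYpos.ne']
  have hXYd : X - Y = L * d := by rw [hd]; field_simp
  set τ : ℝ := R / 32 with hτ
  have hτ0 : 0 < τ := by positivity
  have htd : ∀ t ∈ Icc (0:ℝ) τ, ‖(t : ℂ) * d‖ ≤ τ := by
    intro t ht
    rw [norm_mul, hdn, mul_one, Complex.norm_real, Real.norm_of_nonneg ht.1]; exact ht.2
  set X' : ℂ := X - τ * d with hXp
  have hXpseg : ∀ t ∈ Icc (0:ℝ) τ, ‖X' + t * d - T z0‖ ≤ R / 8 := by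
    intro t ht
    have h1 := htd (τ - t) ⟨by linarith [ht.2], by linarith [ht.1]⟩
    have h2 := norm_sub_le (X - T z0) ((τ - t : ℝ) * d)
    rw [show X' + t * d - T z0 = X - T z0 - ((τ - t : ℝ) : ℂ) * d by rw [hXp]; push_cast; ring]
    linarith
  have hXpV : ∀ t ∈ Icc (0:ℝ) τ, X' + t * d ∈ V := fun t ht => hV0 (by
    rw [Metric.mem_ball, dist_eq_norm]; linarith [hXpseg t ht])
  have hYV : ∀ t ∈ Icc (0:ℝ) τ, Y + t * d ∈ V := fun t ht => hVQ (by
    rw [Metric.mem_ball, dist_eq_norm, add_sub_cancel_left]; linarith [htd t ht])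
  obtain ⟨t1, ht1, h1⟩ := S_mvt hSd hτ0 hdn hXpV
  obtain ⟨t2, ht2, h2⟩ := S_mvt hSd hτ0 hdn hYV
  set Z1 := X' + t1 * d
  set Z2 := Y + t2 * d with hZ2
  have hXpX : X' + τ * d = X := by rw [hXp]; ring
  rw [hXpX] at h1
  have hmid : 0 ≤ inner ℝ d (S X' - S (Y + τ * d)) := by
    have h := hSm X' (by simpa using hXpV 0 ⟨le_rfl, hτ0.le⟩) (Y + τ * d) (hYV τ ⟨hτ0.le, le_rfl⟩)
    have h' : X' - (Y + τ * d) = (L - 2 * τ) • d := by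
      rw [Complex.real_smul, hXp]; push_cast; linear_combination hXYd
    rw [h', inner_smul_left] at h
    exact nonneg_of_mul_nonneg_right h (by simp; linarith)
  have hSY : S Y = Q := (hST Q hQB).1
  have hsum : τ * (1 - (Φ Z1 * d ^ 2).re) / 2 + τ * (1 - (Φ Z2 * d ^ 2).re) / 2
      ≤ 3 * δ / 2 * (R / 16) := by
    have ha : inner ℝ d (S X - Q) = inner ℝ d (S X - S X') + inner ℝ d (S X' - S (Y + τ * d))
        + inner ℝ d (S (Y + τ * d) - S Y) := by
      rw [← inner_add_right, ← inner_add_right, hSY]; congr 1; ring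
    have hb := real_inner_le_norm d (S X - Q)
    rw [hdn, one_mul] at hb
    linarith
  have hZ1V : Z1 ∈ V := hXpV t1 ht1
  have hZ2V : Z2 ∈ V := hYV t2 ht2
  have hn1 : ∀ Z ∈ V, ‖Φ Z * d ^ 2‖ < 1 := fun Z hZ => by
    rw [norm_mul, norm_pow, hdn]; simpa using hΦ1 Z hZ
  have hp1 : 0 ≤ 1 - (Φ Z1 * d ^ 2).re := by
    have := re_one_sub_pos (hn1 Z1 hZ1V); simp at this ⊢; linarith
  have hp2 : 0 ≤ 1 - (Φ Z2 * d ^ 2).re := by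
    have := re_one_sub_pos (hn1 Z2 hZ2V); simp at this ⊢; linarith
  have hsum' : (1 - (Φ Z1 * d ^ 2).re) + (1 - (Φ Z2 * d ^ 2).re) ≤ 6 * δ := by
    have : R * ((1 - (Φ Z1 * d ^ 2).re) + (1 - (Φ Z2 * d ^ 2).re)) ≤ R * (6 * δ) := by
      rw [hτ] at hsum; linarith
    exact le_of_mul_le_mul_left this hR
  have hq1 : ‖1 - Φ Z1 * d ^ 2‖ ≤ √(12 * δ) :=
    Real.le_sqrt_of_sq_le (by linarith [norm_one_sub_sq (hn1 Z1 hZ1V).le])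
  have hq2 : ‖1 - Φ Z2 * d ^ 2‖ ≤ √(12 * δ) :=
    Real.le_sqrt_of_sq_le (by linarith [norm_one_sub_sq (hn1 Z2 hZ2V).le])
  have hballZ2 : Metric.ball Z2 (R / 16) ⊆ V := by
    refine Subset.trans (fun y hy => ?_) hVQ
    rw [Metric.mem_ball, dist_eq_norm] at hy ⊢
    have := norm_add_le (y - Z2) (t2 * d)
    rw [show y - Z2 + t2 * d = y - Y by rw [hZ2]; ring] at this
    linarith [htd t2 ht2]
  have hqY : ‖1 - Φ Y * d ^ 2‖ ≤ 3 * √(12 * δ) := by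
    have := harnack (h := fun X => 1 - Φ X * d ^ 2) (a := Z2) (z := Y) (ρ := R / 16)
      (by positivity) (((hΦd.mono hballZ2).mul_const _).const_sub _)
      (fun X hX => re_one_sub_pos (hn1 X (hballZ2 hX)))
      (by
        rw [show Y - Z2 = -(t2 * d) by rw [hZ2]; ring, norm_neg]
        linarith [htd t2 ht2])
    linarith
  have hYZ : ‖Φ Y - Φ Z1‖ ≤ 4 * √(12 * δ) := by
    have ha : ‖Φ Y - Φ Z1‖ = ‖(1 - Φ Z1 * d ^ 2) - (1 - Φ Y * d ^ 2)‖ := by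
      rw [show (1 - Φ Z1 * d ^ 2) - (1 - Φ Y * d ^ 2) = (Φ Y - Φ Z1) * d ^ 2 by ring, norm_mul,
        norm_pow, hdn]; simp
    rw [ha]
    linarith [norm_sub_le (1 - Φ Z1 * d ^ 2) (1 - Φ Y * d ^ 2)]
  have hfin := norm_add_le (Φ Y - Φ Z1) (Φ Z1 - conj v ^ 2)
  rw [sub_add_sub_cancel] at hfin
  linarith [hclose Z1 (hXpseg t1 ht1)]

end LoD

namespace LoD
open Complex ComplexConjugate

lemma mse_derivs {u : ℝ × ℝ → ℝ} {Ω : Set (ℝ × ℝ)} (hΩ : IsOpen Ω) (hu : IsMSE u Ω)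
    {z : ℝ × ℝ} (hz : z ∈ Ω) :
    ∃ p' q' : ℝ × ℝ →L[ℝ] ℝ, HasFDerivAt (pd1 u) p' z ∧ HasFDerivAt (pd2 u) q' z ∧
      p' (0, 1) = q' (1, 0) ∧
      (1 + pd2 u z ^ 2) * p' (1, 0) - 2 * pd1 u z * pd2 u z * p' (0, 1)
        + (1 + pd1 u z ^ 2) * q' (0, 1) = 0 := by
  have hline1 : ∀ z : ℝ × ℝ, HasDerivAt (fun t : ℝ => (t, z.2)) ((1, 0) : ℝ × ℝ) z.1 :=
    fun z => (hasDerivAt_id z.1).prodMk (hasDerivAt_const _ _)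
  have hline2 : ∀ z : ℝ × ℝ, HasDerivAt (fun t : ℝ => (z.1, t)) ((0, 1) : ℝ × ℝ) z.2 :=
    fun z => (hasDerivAt_const _ _).prodMk (hasDerivAt_id z.2)
  have hp1 : ∀ (f : ℝ × ℝ → ℝ) (f' : ℝ × ℝ →L[ℝ] ℝ) (z : ℝ × ℝ), HasFDerivAt f f' z →
      pd1 f z = f' (1, 0) := fun f f' z h =>
    (HasFDerivAt.comp_hasDerivAt z.1 (f := fun t : ℝ => (t, z.2)) h (hline1 z)).deriv
  have hp2 : ∀ (f : ℝ × ℝ → ℝ) (f' : ℝ × ℝ →L[ℝ] ℝ) (z : ℝ × ℝ), HasFDerivAt f f' z →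
      pd2 f z = f' (0, 1) := fun f f' z h =>
    (HasFDerivAt.comp_hasDerivAt z.2 (f := fun t : ℝ => (z.1, t)) h (hline2 z)).deriv
  have hc : ∀ z ∈ Ω, ContDiffAt ℝ 2 u z := fun z hz => hu.1.contDiffAt (hΩ.mem_nhds hz)
  have hd : ∀ z ∈ Ω, HasFDerivAt u (fderiv ℝ u z) z := fun z hz =>
    ((hc z hz).differentiableAt (by norm_num)).hasFDerivAt
  have hdd : HasFDerivAt (fderiv ℝ u) (fderiv ℝ (fderiv ℝ u) z) z :=
    (((hc z hz).fderiv_right (m := 1) (by norm_num)).differentiableAt (by norm_num)).hasFDerivAt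
  have hsym : IsSymmSndFDerivAt ℝ u z := (hc z hz).isSymmSndFDerivAt (by simp)
  have hP : HasFDerivAt (pd1 u) ((fderiv ℝ (fderiv ℝ u) z).flip (1, 0)) z := by
    have h1 : HasFDerivAt (fun y => fderiv ℝ u y (1, 0))
        ((fderiv ℝ (fderiv ℝ u) z).flip (1, 0)) z := by
      simpa using hdd.clm_apply (hasFDerivAt_const ((1, 0) : ℝ × ℝ) z)
    refine h1.congr_of_eventuallyEq ?_
    filter_upwards [hΩ.mem_nhds hz] with y hy
    exact hp1 u _ y (hd y hy)
  have hQ : HasFDerivAt (pd2 u) ((fderiv ℝ (fderiv ℝ u) z).flip (0, 1)) z := by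
    have h1 : HasFDerivAt (fun y => fderiv ℝ u y (0, 1))
        ((fderiv ℝ (fderiv ℝ u) z).flip (0, 1)) z := by
      simpa using hdd.clm_apply (hasFDerivAt_const ((0, 1) : ℝ × ℝ) z)
    refine h1.congr_of_eventuallyEq ?_
    filter_upwards [hΩ.mem_nhds hz] with y hy
    exact hp2 u _ y (hd y hy)
  refine ⟨_, _, hP, hQ, ?_, ?_⟩
  · simpa using hsym (0, 1) (1, 0)
  · have := hu.2 z hz
    rwa [hp1 _ _ z hP, hp2 _ _ z hP, hp2 _ _ z hQ] at this

/-- the identification `ℂ → ℝ × ℝ` -/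
noncomputable def io (z : ℂ) : ℝ × ℝ := (z.re, z.im)

lemma io_hasFDerivAt (z : ℂ) :
    HasFDerivAt io (Complex.reCLM.prod Complex.imCLM) z :=
  (Complex.reCLM.hasFDerivAt (x := z)).prodMk (Complex.imCLM.hasFDerivAt (x := z))

lemma io_cont : Continuous io := Complex.continuous_re.prodMk Complex.continuous_im

/-- The (conjugated) Gauss map in the disc. -/
noncomputable def gg (u : ℝ × ℝ → ℝ) (z : ℂ) : ℂ :=
  ((pd1 u (io z) : ℂ) + pd2 u (io z) * I) / ((1 + Wg u (io z) : ℝ) : ℂ)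

lemma Wg_sq (u : ℝ × ℝ → ℝ) (z : ℝ × ℝ) : Wg u z ^ 2 = 1 + pd1 u z ^ 2 + pd2 u z ^ 2 :=
  Real.sq_sqrt (by positivity)

lemma Wg_pos (u : ℝ × ℝ → ℝ) (z : ℝ × ℝ) : 0 < Wg u z := Real.sqrt_pos.2 (by positivity)

lemma gg_norm_sq (u : ℝ × ℝ → ℝ) (z : ℂ) :
    ‖gg u z‖ ^ 2 = (Wg u (io z) - 1) / (Wg u (io z) + 1) := by
  have hW := Wg_pos u (io z)
  have h2 := Wg_sq u (io z)
  rw [gg, norm_div, div_pow, Complex.norm_real, Real.norm_of_nonneg (by positivity),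
    ← Complex.normSq_eq_norm_sq, Complex.normSq_add_mul_I]
  rw [show pd1 u (io z) ^ 2 + pd2 u (io z) ^ 2 = (Wg u (io z) - 1) * (Wg u (io z) + 1) by
    linear_combination -h2]
  field_simp
  ring

lemma gg_lt (u : ℝ × ℝ → ℝ) (z : ℂ) : ‖gg u z‖ < 1 := by
  have hW := Wg_pos u (io z)
  have h : ‖gg u z‖ ^ 2 < 1 := by
    rw [gg_norm_sq, div_lt_one (by positivity)]; linarith
  nlinarith [norm_nonneg (gg u z)]

/-- constant maps used to write `AA` in coordinates -/
noncomputable def L1 : ℂ →L[ℝ] ℂ := Complex.ofRealCLM.comp Complex.reCLM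
noncomputable def L3 : ℂ →L[ℝ] ℂ := (I : ℂ) • Complex.ofRealCLM.comp Complex.imCLM
noncomputable def L2 : ℂ →L[ℝ] ℂ :=
  Complex.ofRealCLM.comp Complex.imCLM + (I : ℂ) • Complex.ofRealCLM.comp Complex.reCLM

lemma AA_coord (u : ℝ × ℝ → ℝ) (z : ℂ) :
    AA (gg u z ^ 2) = (1 + (1 + pd1 u (io z) ^ 2) * (Wg u (io z))⁻¹) • L1
      + (pd1 u (io z) * pd2 u (io z) * (Wg u (io z))⁻¹) • L2
      + (1 + (1 + pd2 u (io z) ^ 2) * (Wg u (io z))⁻¹) • L3 := by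
  have hW := Wg_pos u (io z)
  have h2 := Wg_sq u (io z)
  have h3 := gg_norm_sq u z
  set W := Wg u (io z) with hWd
  set p := pd1 u (io z) with hp
  set q := pd2 u (io z) with hq
  have h4 : 2 / (1 - ‖gg u z ^ 2‖ ^ 2) = (W + 1) ^ 2 / (2 * W) := by
    rw [norm_pow, h3]
    have : 1 - ((W - 1) / (W + 1)) ^ 2 = 4 * W / (W + 1) ^ 2 := by field_simp; ring
    rw [this]; field_simp; norm_num
  have h5 : gg u z ^ 2 = (((p ^ 2 - q ^ 2) / (1 + W) ^ 2 : ℝ) : ℂ)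
      + ((2 * p * q / (1 + W) ^ 2 : ℝ) : ℂ) * I := by
    rw [gg, div_pow, add_sq, mul_pow, Complex.I_sq]
    push_cast
    ring
  ext1 d
  rw [AA_apply, h4, h5]
  have h6 : p ^ 2 = W ^ 2 - 1 - q ^ 2 := by linarith
  apply Complex.ext
  · simp [L1, L2, L3, -Complex.ofReal_div, -Complex.ofReal_pow, -Complex.ofReal_mul, -Complex.ofReal_add, -Complex.ofReal_sub]
    field_simp
    rw [h6]; ring
  · simp [L1, L2, L3, -Complex.ofReal_div, -Complex.ofReal_pow, -Complex.ofReal_mul, -Complex.ofReal_add, -Complex.ofReal_sub]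
    field_simp
    rw [h6]; ring

lemma closed_form {α' β' γ' : ℂ →L[ℝ] ℝ}
    (h1 : β' 1 = α' I) (h2 : γ' 1 = β' I) (x y : ℂ) :
    (α'.smulRight L1 + β'.smulRight L2 + γ'.smulRight L3) x y
      = (α'.smulRight L1 + β'.smulRight L2 + γ'.smulRight L3) y x := by
  have key : ∀ (l : ℂ →L[ℝ] ℝ) (x : ℂ), l x = x.re * l 1 + x.im * l I := by
    intro l x
    have : x = x.re • (1 : ℂ) + x.im • I := by simp
    conv_lhs => rw [this]
    rw [map_add, map_smul, map_smul]; simp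
  simp only [add_apply, ContinuousLinearMap.smulRight_apply,
    smul_apply]
  rw [key α' x, key α' y, key β' x, key β' y, key γ' x, key γ' y, h1, h2]
  apply Complex.ext <;> simp [L1, L2, L3] <;> ring

lemma exists_T {u : ℝ × ℝ → ℝ} {Ω : Set (ℝ × ℝ)} (hΩ : IsOpen Ω) (hu : IsMSE u Ω)
    {z0 : ℂ} {R : ℝ} (hB : ∀ z ∈ Metric.ball z0 R, io z ∈ Ω) :
    ∃ T : ℂ → ℂ, ∀ z ∈ Metric.ball z0 R, HasFDerivAt T (AA (gg u z ^ 2)) z := by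
  have main : ∀ z ∈ Metric.ball z0 R, ∃ dω : ℂ →L[ℝ] ℂ →L[ℝ] ℂ,
      HasFDerivAt (fun z => AA (gg u z ^ 2)) dω z ∧ ∀ x y, dω x y = dω y x := by
    intro z hz
    obtain ⟨p', q', hp, hq, hs, hm⟩ := mse_derivs hΩ hu (hB z hz)
    have hp := hp.comp z (io_hasFDerivAt z)
    have hq := hq.comp z (io_hasFDerivAt z)
    set PP := p' ∘SL Complex.reCLM.prod Complex.imCLM with hPP
    set QQ := q' ∘SL Complex.reCLM.prod Complex.imCLM with hQQ
    have hP1 : PP 1 = p' (1, 0) := by simp [hPP]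
    have hP2 : PP I = p' (0, 1) := by simp [hPP]
    have hQ1 : QQ 1 = q' (1, 0) := by simp [hQQ]
    have hQ2 : QQ I = q' (0, 1) := by simp [hQQ]
    replace hp : HasFDerivAt (fun z => pd1 u (io z)) PP z := hp
    replace hq : HasFDerivAt (fun z => pd2 u (io z)) QQ z := hq
    have hpos : 0 < 1 + pd1 u (io z) ^ 2 + pd2 u (io z) ^ 2 := by positivity
    have h2 := Wg_sq u (io z)
    have hWp := Wg_pos u (io z)
    have hW : HasFDerivAt (fun z => (Wg u (io z))⁻¹)
        ((-(Wg u (io z) ^ 3)⁻¹) • (pd1 u (io z) • PP + pd2 u (io z) • QQ)) z := by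
      have h0 : HasFDerivAt (fun z => Wg u (io z)) _ z :=
        (((hp.pow 2).const_add 1).add (hq.pow 2)).sqrt hpos.ne'
      have h1 := (hasDerivAt_inv hWp.ne').comp_hasFDerivAt z h0
      refine h1.congr_fderiv ?_
      have hWW : √(((fun x : ℂ => 1 + pd1 u (io x) ^ 2) + (fun x : ℂ => pd2 u (io x) ^ 2) : ℂ → ℝ) z)
        = Wg u (io z) := rfl
      rw [hWW]
      ext x <;> simp <;> field_simp
    have hα := (((hp.pow 2).const_add 1).mul hW).const_add 1
    have hβ := (hp.mul hq).mul hW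
    have hγ := (((hq.pow 2).const_add 1).mul hW).const_add 1
    have h := ((hα.smul_const L1).add (hβ.smul_const L2)).add (hγ.smul_const L3)
    refine ⟨_, h.congr_of_eventuallyEq (Eventually.of_forall fun y => AA_coord u y),
      closed_form ?_ ?_⟩
    · simp [hP1, hP2, hQ1, hQ2]
      field_simp
      rw [← hs, h2]
      linear_combination (pd2 u (io z)) * hm
    · simp [hP1, hP2, hQ1, hQ2]
      field_simp
      rw [← hs, h2]
      linear_combination (-pd1 u (io z)) * hm
  choose! dω h1 h2 using main
  obtain ⟨T, hT⟩ := (convex_ball z0 R).exists_forall_hasFDerivWithinAt_of_hasFDerivWithinAt_symmetric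
    (fun z hz => (h1 z hz).hasFDerivWithinAt) (fun z hz x _ y _ => h2 z hz x y)
  exact ⟨T, fun z hz => (hT z hz).hasFDerivAt (Metric.isOpen_ball.mem_nhds hz)⟩

end LoD

namespace LoD
open Complex ComplexConjugate

lemma gg_cont {u : ℝ × ℝ → ℝ} {Ω : Set (ℝ × ℝ)} (hΩ : IsOpen Ω) (hu : IsMSE u Ω)
    {z : ℂ} (hz : io z ∈ Ω) : ContinuousAt (gg u) z := by
  obtain ⟨p', q', hp, hq, -, -⟩ := mse_derivs hΩ hu hz
  have hp : ContinuousAt (fun z => pd1 u (io z)) z := hp.continuousAt.comp io_cont.continuousAt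
  have hq : ContinuousAt (fun z => pd2 u (io z)) z := hq.continuousAt.comp io_cont.continuousAt
  have hW : ContinuousAt (fun z => Wg u (io z)) z :=
    ((continuousAt_const.add (hp.pow 2)).add (hq.pow 2)).sqrt
  refine ContinuousAt.div ?_ ?_ ?_
  · exact (Complex.continuous_ofReal.continuousAt.comp hp).add
      ((Complex.continuous_ofReal.continuousAt.comp hq).mul continuousAt_const)
  · exact Complex.continuous_ofReal.continuousAt.comp (continuousAt_const.add hW)
  · have := Wg_pos u (io z)
    exact_mod_cast (by positivity : (0:ℝ) < 1 + Wg u (io z)).ne'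

lemma local_est {u : ℝ × ℝ → ℝ} {Ω : Set (ℝ × ℝ)} (hΩ : IsOpen Ω) (hu : IsMSE u Ω)
    {z0 : ℂ} {R : ℝ} (hR : 0 < R) (hB : ∀ z ∈ Metric.ball z0 R, io z ∈ Ω)
    {v : ℂ} (hv : ‖v‖ = 1) {ε : ℝ} (hε : ‖gg u z0 - v‖ ≤ ε) (hε1 : ε < 1)
    (hε2 : 3 * (2 * ε) + 4 * √(12 * (2 * ε)) < 1) {s : ℝ} (hs : |s| ≤ R / 16) :
    ‖gg u (z0 + s * (I * v)) - v‖ ≤ 3 * (2 * ε) + 4 * √(12 * (2 * ε)) := by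
  obtain ⟨T, hT⟩ := exists_T hΩ hu hB
  have hG : ∀ z ∈ Metric.ball z0 R, ‖gg u z ^ 2‖ < 1 := fun z _ => by
    rw [norm_pow]; nlinarith [norm_nonneg (gg u z), gg_lt u z]
  have hδ : ‖gg u z0 ^ 2 - v ^ 2‖ ≤ 2 * ε := by
    rw [sq_sub_sq, norm_mul]
    have h1 := norm_add_le (gg u z0) v
    rw [hv] at h1
    have h2 := gg_lt u z0
    exact mul_le_mul (by linarith) hε (norm_nonneg _) (by norm_num)
  have hest : ∀ t : ℝ, |t| ≤ R / 16 →
      ‖gg u (z0 + t * (I * v)) ^ 2 - v ^ 2‖ ≤ 3 * (2 * ε) + 4 * √(12 * (2 * ε)) :=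
    fun t ht => main_est hR hG hT hv hδ ht
  have hvv : v * conj v = 1 := by
    rw [Complex.mul_conj, Complex.normSq_eq_norm_sq, hv]; simp
  -- nonvanishing
  have hnz : ∀ w : ℂ, ‖w ^ 2 - v ^ 2‖ < 1 → (w * conj v).re ≠ 0 := by
    intro w hw h0
    have h1 : ‖(w * conj v) ^ 2 - 1‖ < 1 := by
      rw [show (w * conj v) ^ 2 - 1 = (w ^ 2 - v ^ 2) * conj v ^ 2 by
        linear_combination (v * conj v + 1) * hvv, norm_mul, norm_pow, RCLike.norm_conj, hv]
      simpa using hw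
    have h2 := (abs_lt.1 ((Complex.abs_re_le_norm _).trans_lt h1)).1
    rw [Complex.sub_re, sq, Complex.mul_re, h0] at h2
    simp only [Complex.one_re] at h2
    nlinarith [sq_nonneg (w * conj v).im]
  set f : ℝ → ℝ := fun t => (gg u (z0 + (t * s : ℝ) * (I * v)) * conj v).re with hf
  have hts : ∀ t ∈ Icc (0:ℝ) 1, |t * s| ≤ R / 16 := by
    intro t ht
    rw [abs_mul, abs_of_nonneg ht.1]
    nlinarith [abs_nonneg s, ht.1, ht.2]
  have hfc : ContinuousOn f (Icc 0 1) := by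
    intro t ht
    have h1 : io (z0 + (t * s : ℝ) * (I * v)) ∈ Ω := hB _ (by
      rw [Metric.mem_ball, dist_eq_norm, add_sub_cancel_left, norm_mul, norm_mul, hv,
        Complex.norm_I, Complex.norm_real, Real.norm_eq_abs]
      linarith [hts t ht])
    have h2 : ContinuousAt (fun t : ℝ => gg u (z0 + (t * s : ℝ) * (I * v))) t :=
      ContinuousAt.comp (f := fun t : ℝ => z0 + (t * s : ℝ) * (I * v)) (gg_cont hΩ hu h1)
        (by fun_prop)
    exact (Complex.continuous_re.continuousAt.comp (h2.mul continuousAt_const)).continuousWithinAt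
  have hf0 : 0 < f 0 := by
    have h1 : ‖gg u z0 * conj v - 1‖ < 1 := by
      rw [show gg u z0 * conj v - 1 = (gg u z0 - v) * conj v by linear_combination hvv,
        norm_mul, RCLike.norm_conj, hv]
      linarith
    have h2 := (abs_lt.1 ((Complex.abs_re_le_norm _).trans_lt h1)).1
    simp only [Complex.sub_re, Complex.one_re] at h2
    simp only [hf, zero_mul, Complex.ofReal_zero, add_zero]
    linarith
  have hf1 : 0 < f 1 := by
    by_contra hcon
    push Not at hcon
    obtain ⟨t, ht, h0⟩ := intermediate_value_Icc' zero_le_one hfc ⟨hcon, hf0.le⟩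
    exact hnz _ ((hest _ (hts t ht)).trans_lt hε2) h0
  simp only [hf, one_mul] at hf1
  set w := gg u (z0 + s * (I * v)) with hw
  have h3 : 1 ≤ ‖w + v‖ := by
    have h4 := Complex.re_le_norm ((w + v) * conj v)
    rw [norm_mul, RCLike.norm_conj, hv, add_mul, hvv] at h4
    simp only [Complex.add_re, Complex.one_re, mul_one] at h4
    linarith
  have h5 := hest s hs
  rw [sq_sub_sq, norm_mul] at h5
  nlinarith [norm_nonneg (w - v)]

lemma local_tendsto {Ω : Set (ℝ × ℝ)} (hΩ : IsOpen Ω) {u : ℕ → ℝ × ℝ → ℝ}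
    (hu : ∀ n, IsMSE (u n) Ω) {z0 : ℂ} {R : ℝ} (hR : 0 < R)
    (hB : ∀ z ∈ Metric.ball z0 R, io z ∈ Ω) {v : ℂ} (hv : ‖v‖ = 1) {s : ℝ} (hs : |s| ≤ R / 16)
    (h : Tendsto (fun n => gg (u n) z0) atTop (𝓝 v)) :
    Tendsto (fun n => gg (u n) (z0 + s * (I * v))) atTop (𝓝 v) := by
  have h1 := tendsto_iff_norm_sub_tendsto_zero.1 h
  have hF : Continuous (fun ε : ℝ => 3 * (2 * ε) + 4 * √(12 * (2 * ε))) := by fun_prop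
  have h2 : Tendsto (fun n => 3 * (2 * ‖gg (u n) z0 - v‖) + 4 * √(12 * (2 * ‖gg (u n) z0 - v‖)))
      atTop (𝓝 0) := by
    have := (hF.tendsto 0).comp h1
    simpa [Function.comp_def] using this
  rw [tendsto_iff_norm_sub_tendsto_zero]
  refine squeeze_zero' (Eventually.of_forall fun n => norm_nonneg _) ?_ h2
  filter_upwards [h1.eventually_lt_const zero_lt_one, h2.eventually_lt_const zero_lt_one]
    with n hn1 hn2
  exact local_est hΩ (hu n) hR hB hv le_rfl hn1 hn2 hs

lemma tendsto_iff {u : ℕ → ℝ × ℝ → ℝ} {z v : ℂ} (hv : ‖v‖ = 1) :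
    Tendsto (fun n => Nvec (u n) (io z)) atTop (𝓝 (v.re, v.im, 0)) ↔
      Tendsto (fun n => gg (u n) z) atTop (𝓝 v) := by
  constructor
  · intro h
    have h1 : Tendsto (fun n => pd1 (u n) (io z) / Wg (u n) (io z)) atTop (𝓝 v.re) :=
      (continuous_fst.tendsto _).comp h
    have h2 : Tendsto (fun n => pd2 (u n) (io z) / Wg (u n) (io z)) atTop (𝓝 v.im) :=
      ((continuous_fst.comp continuous_snd).tendsto _).comp h
    have h3 : Tendsto (fun n => -1 / Wg (u n) (io z)) atTop (𝓝 0) :=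
      ((continuous_snd.comp continuous_snd).tendsto _).comp h
    have h4 : Tendsto (fun n => (((pd1 (u n) (io z) / Wg (u n) (io z) : ℝ) : ℂ)
        + ((pd2 (u n) (io z) / Wg (u n) (io z) : ℝ) : ℂ) * I)
          / ((1 - -1 / Wg (u n) (io z) : ℝ) : ℂ)) atTop
        (𝓝 (((v.re : ℂ) + (v.im : ℂ) * I) / ((1 - 0 : ℝ) : ℂ))) := by
      refine Tendsto.div (Tendsto.add ?_ (Tendsto.mul_const _ ?_)) ?_ (by simp)
      · exact (Complex.continuous_ofReal.tendsto _).comp h1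
      · exact (Complex.continuous_ofReal.tendsto _).comp h2
      · exact (Complex.continuous_ofReal.tendsto _).comp (h3.const_sub 1)
    have h5 : ((v.re : ℂ) + (v.im : ℂ) * I) / ((1 - 0 : ℝ) : ℂ) = v := by
      rw [Complex.re_add_im]; simp
    rw [h5] at h4
    refine h4.congr fun n => ?_
    have hW := Wg_pos (u n) (io z)
    have hW1 : (Wg (u n) (io z) : ℂ) ≠ 0 := by exact_mod_cast hW.ne'
    have hW2 : ((1 + Wg (u n) (io z) : ℝ) : ℂ) ≠ 0 := by
      exact_mod_cast (by positivity : (0:ℝ) < 1 + Wg (u n) (io z)).ne'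
    have e1 : (1 - -1 / Wg (u n) (io z)) = (1 + Wg (u n) (io z)) / Wg (u n) (io z) := by
      field_simp; ring
    rw [gg, e1]
    push_cast at hW2 ⊢
    field_simp
  · intro h
    have hn : Tendsto (fun n => ‖gg (u n) z‖ ^ 2) atTop (𝓝 1) := by
      simpa [hv] using h.norm.pow 2
    have hre : Tendsto (fun n => (gg (u n) z).re) atTop (𝓝 v.re) :=
      (Complex.continuous_re.tendsto _).comp h
    have him : Tendsto (fun n => (gg (u n) z).im) atTop (𝓝 v.im) :=
      (Complex.continuous_im.tendsto _).comp h
    have hden : Tendsto (fun n => 1 + ‖gg (u n) z‖ ^ 2) atTop (𝓝 (1 + 1)) := hn.const_add 1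
    have h1 := (hre.const_mul 2).div hden (by norm_num)
    have h2 := (him.const_mul 2).div hden (by norm_num)
    have h3 := (hn.sub_const 1).div hden (by norm_num)
    have h4 := h1.prodMk_nhds (h2.prodMk_nhds h3)
    have e : ((2 * v.re / (1 + 1), 2 * v.im / (1 + 1), (1 - 1) / (1 + 1)) : ℝ × ℝ × ℝ)
        = (v.re, v.im, 0) := by
      ext <;> simp <;> ring
    rw [e] at h4
    refine h4.congr fun n => ?_
    have hW := Wg_pos (u n) (io z)
    have e1 : (gg (u n) z).re = pd1 (u n) (io z) / (1 + Wg (u n) (io z)) := by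
      rw [gg, Complex.div_ofReal_re]; simp
    have e2 : (gg (u n) z).im = pd2 (u n) (io z) / (1 + Wg (u n) (io z)) := by
      rw [gg, Complex.div_ofReal_im]; simp
    have e3 : 1 + (Wg (u n) (io z) - 1) / (Wg (u n) (io z) + 1)
        = 2 * Wg (u n) (io z) / (1 + Wg (u n) (io z)) := by field_simp; ring
    have e4 : (Wg (u n) (io z) - 1) / (Wg (u n) (io z) + 1) - 1
        = -2 / (1 + Wg (u n) (io z)) := by field_simp; ring
    simp only [Pi.div_apply, Nvec, gg_norm_sq, e1, e2, e3, e4]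
    ext <;> simp <;> field_simp

end LoD

/-- Lines of divergence: let `(u_n)` be a sequence of solutions of the minimal surfaces
equation on an open connected set `Ω`, `P ∈ Ω`, `v` a unit vector and `D` the connected
component of `P` in the intersection of `Ω` with the line through `P` orthogonal to `v`.
If the downward normals `N_n(P)` converge to the horizontal vector `(v₁, v₂, 0)`, then
`N_n(Q) → (v₁, v₂, 0)` at every point `Q` of `D`. -/
theorem line_of_divergence_global
    (Ω : Set (ℝ × ℝ)) (hΩo : IsOpen Ω) (hΩc : IsConnected Ω)
    (u : ℕ → ℝ × ℝ → ℝ) (hu : ∀ n, IsMSE (u n) Ω)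
    (P : ℝ × ℝ) (hP : P ∈ Ω)
    (v : ℝ × ℝ) (hv : len v = 1)
    (D : Set (ℝ × ℝ))
    (hD : D = connectedComponentIn
      (Ω ∩ {z : ℝ × ℝ | (z.1 - P.1) * v.1 + (z.2 - P.2) * v.2 = 0}) P)
    (hNP : Tendsto (fun n => Nvec (u n) P) atTop (𝓝 (v.1, v.2, 0))) :
    ∀ Q ∈ D, Tendsto (fun n => Nvec (u n) Q) atTop (𝓝 (v.1, v.2, 0)) := by
  classical
  intro Q hQ
  set F := Ω ∩ {z : ℝ × ℝ | (z.1 - P.1) * v.1 + (z.2 - P.2) * v.2 = 0} with hF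
  set ev : ℂ := ⟨v.1, v.2⟩ with hev
  have hv2 : v.1 ^ 2 + v.2 ^ 2 = 1 := by
    have h := hv
    rw [len, Real.sqrt_eq_one] at h
    exact h
  have hevn : ‖ev‖ = 1 := by
    have : ‖ev‖ ^ 2 = 1 := by
      rw [← Complex.normSq_eq_norm_sq, Complex.normSq_apply, hev]
      linarith
    nlinarith [norm_nonneg ev]
  have hDF : D ⊆ F := hD ▸ connectedComponentIn_subset F P
  have hDc : IsPreconnected D := hD ▸ isPreconnected_connectedComponentIn
  have hPD : P ∈ D := by
    rw [hD]
    exact mem_connectedComponentIn ⟨hP, by simp⟩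
  let ka : ℝ × ℝ → ℂ := fun z => ⟨z.1, z.2⟩
  have hka : ∀ z, LoD.io (ka z) = z := fun z => rfl
  have hkac : Continuous ka := Complex.equivRealProdCLM.symm.continuous
  let A : ℝ × ℝ → Prop := fun Q => Tendsto (fun n => Nvec (u n) Q) atTop (𝓝 (v.1, v.2, 0))
  have hA : ∀ Q, A Q ↔ Tendsto (fun n => LoD.gg (u n) (ka Q)) atTop (𝓝 ev) := fun Q =>
    LoD.tendsto_iff (z := ka Q) hevn
  -- two points of the line
  have hline : ∀ X ∈ F, ∀ Y ∈ F, ∃ s : ℝ, |s| = ‖ka Y - ka X‖ ∧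
      ka Y = ka X + s * (Complex.I * ev) := by
    intro X hX Y hY
    have hX2 : (X.1 - P.1) * v.1 + (X.2 - P.2) * v.2 = 0 := hX.2
    have hY2 : (Y.1 - P.1) * v.1 + (Y.2 - P.2) * v.2 = 0 := hY.2
    have h0 : (Y.1 - X.1) * v.1 + (Y.2 - X.2) * v.2 = 0 := by linarith
    have h1 : ka Y = ka X + ((-(Y.1 - X.1) * v.2 + (Y.2 - X.2) * v.1 : ℝ) : ℂ)
        * (Complex.I * ev) := by
      apply Complex.ext
      · simp only [Complex.add_re, Complex.re_ofReal_mul, Complex.I_mul_re]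
        show Y.1 = X.1 + (-(Y.1 - X.1) * v.2 + (Y.2 - X.2) * v.1) * -v.2
        linear_combination (X.1 - Y.1) * hv2 + v.1 * h0
      · simp only [Complex.add_im, Complex.im_ofReal_mul, Complex.I_mul_im]
        show Y.2 = X.2 + (-(Y.1 - X.1) * v.2 + (Y.2 - X.2) * v.1) * v.1
        linear_combination (X.2 - Y.2) * hv2 + v.2 * h0
    refine ⟨_, ?_, h1⟩
    rw [h1, add_sub_cancel_left, norm_mul, norm_mul, hevn, Complex.norm_I, Complex.norm_real,
      Real.norm_eq_abs]
    simp
  have hloc : ∀ X ∈ D, ∀ᶠ Y in 𝓝[D] X, (A Y ↔ A X) := by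
    intro X hX
    have hXF := hDF hX
    have hopen : IsOpen (LoD.io ⁻¹' Ω) := hΩo.preimage LoD.io_cont
    obtain ⟨R, hR, hball⟩ := Metric.isOpen_iff.1 hopen (ka X) hXF.1
    have hnear : ∀ᶠ Y in 𝓝[D] X, ‖ka Y - ka X‖ < R / 64 := by
      have : ∀ᶠ Y in 𝓝 X, ka Y ∈ Metric.ball (ka X) (R / 64) :=
        hkac.continuousAt.eventually_mem (Metric.ball_mem_nhds _ (by positivity))
      filter_upwards [this.filter_mono nhdsWithin_le_nhds] with Y hY
      rwa [Metric.mem_ball, dist_eq_norm] at hY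
    filter_upwards [hnear, self_mem_nhdsWithin] with Y hY hYD
    have hYF := hDF hYD
    rw [hA, hA]
    constructor
    · intro h
      obtain ⟨s, hs, he⟩ := hline Y hYF X hXF
      rw [he]
      refine LoD.local_tendsto hΩo hu (R := R / 2) (by positivity) (fun z hz => ?_) hevn ?_ h
      · apply hball
        rw [Metric.mem_ball] at hz ⊢
        have := dist_triangle z (ka Y) (ka X)
        rw [dist_eq_norm (ka Y)] at this
        linarith
      · rw [hs, norm_sub_rev]; linarith
    · intro h
      obtain ⟨s, hs, he⟩ := hline X hXF Y hYF
      rw [he]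
      refine LoD.local_tendsto hΩo hu hR (fun z hz => hball hz) hevn ?_ h
      rw [hs]; linarith
  have hcont : ContinuousOn (fun X => decide (A X)) D := by
    intro X hX
    refine tendsto_nhds_of_eventually_eq ?_
    filter_upwards [hloc X hX] with Y hY
    exact decide_eq_decide.2 hY
  have := hDc.constant hcont hQ hPD
  exact (decide_eq_decide.1 this).2 hNP
end
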